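/- arXiv:math/0005311 — 2 statements merged into one kernel-verified Lean document; each statement's English description precedes it below -/
import Mathlib

section
/- Let K be a field with prime field E_0, and let T be a set of variables with card(T) ≥ trans.deg(K/E_0). Let F_0 be either E_0 or ℚ. Then there is a field L, algebraic over the rational function field F_0(T), such that the absolute Galois group G(L) is isomorphic (as a profinite group) to G(K). -/
/-- The absolute Galois group `Gal(K_s/K)` of a field `K`. -/
abbrev AbsGal (K : Type) [Field K] : Type :=
  ↥(separableClosure K (AlgebraicClosure K)) ≃ₐ[K] ↥(separableClosure K (AlgebraicClosure K))

section
open scoped TensorProduct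

/-- A trace-one element for an open normal subgroup of the Galois group. -/
lemma exists_trace_one {k κ : Type*} [Field k] [Field κ] [Algebra k κ] [IsGalois k κ]
    (U : Subgroup (κ ≃ₐ[k] κ)) [U.Normal] (hU : IsOpen (U : Set (κ ≃ₐ[k] κ)))
    [Fintype ((κ ≃ₐ[k] κ) ⧸ U)] :
    ∃ t : κ, (∀ u ∈ U, u t = t) ∧ ∑ d : (κ ≃ₐ[k] κ) ⧸ U, (d.out : κ ≃ₐ[k] κ) t = 1 := by
  classical
  set N := IntermediateField.fixedField U with hN
  have hfix : N.fixingSubgroup = U :=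
    InfiniteGalois.fixingSubgroup_fixedField ⟨U, U.isClosed_of_isOpen hU⟩
  have hNU : ∀ x : N, ∀ u ∈ U, u (x : κ) = x := fun x u hu => x.2 ⟨u, hu⟩
  -- the action on elements fixed by `U`
  have hact : ∀ (g : κ ≃ₐ[k] κ) (d : (κ ≃ₐ[k] κ) ⧸ U) (x : κ), (∀ u ∈ U, u x = x) →
      g ((d.out : κ ≃ₐ[k] κ) x) = (((g : (κ ≃ₐ[k] κ) ⧸ U) * d).out : κ ≃ₐ[k] κ) x := by
    intro g d x hx
    have h : (((g : (κ ≃ₐ[k] κ) ⧸ U) * d).out)⁻¹ * (g * d.out) ∈ U := by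
      rw [← QuotientGroup.eq]
      simp
    have := congrArg (((g : (κ ≃ₐ[k] κ) ⧸ U) * d).out) (hx _ h)
    rw [← AlgEquiv.mul_apply, mul_inv_cancel_left] at this
    simpa using this
  let ψ : (κ ≃ₐ[k] κ) ⧸ U → (N →* κ) := fun d =>
    ((d.out : κ ≃ₐ[k] κ) : κ →* κ).comp (N.val : N →* κ)
  have hψ : Function.Injective ψ := by
    intro d d' h
    rw [← QuotientGroup.out_eq' d, ← QuotientGroup.out_eq' d', QuotientGroup.eq]
    refine hfix.le ((IntermediateField.mem_fixingSubgroup_iff _ _).mpr ?_)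
    intro x hx
    have := DFunLike.congr_fun h ⟨x, hx⟩
    have h2 : (d.out : κ ≃ₐ[k] κ) x = (d'.out : κ ≃ₐ[k] κ) x := this
    rw [AlgEquiv.mul_apply, ← h2, ← AlgEquiv.mul_apply, inv_mul_cancel]
    rfl
  have hli := (linearIndependent_monoidHom N κ).comp ψ hψ
  rw [Fintype.linearIndependent_iff] at hli
  have : ∃ y : N, ∑ d : (κ ≃ₐ[k] κ) ⧸ U, (d.out : κ ≃ₐ[k] κ) (y : κ) ≠ 0 := by
    by_contra! hcon
    have := hli (fun _ => 1) (by
      ext y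
      simpa [ψ] using hcon y) (1 : (κ ≃ₐ[k] κ) ⧸ U)
    exact one_ne_zero this
  obtain ⟨y, hy⟩ := this
  set s := ∑ d : (κ ≃ₐ[k] κ) ⧸ U, (d.out : κ ≃ₐ[k] κ) (y : κ) with hs
  have hsinv : ∀ g : κ ≃ₐ[k] κ, g s = s := by
    intro g
    rw [hs, map_sum]
    rw [← Equiv.sum_comp (Equiv.mulLeft (g : (κ ≃ₐ[k] κ) ⧸ U))
      (fun d => (d.out : κ ≃ₐ[k] κ) (y : κ))]
    exact Finset.sum_congr rfl fun d _ => hact g d y (hNU y)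
  refine ⟨y / s, fun u hu => by rw [map_div₀, hsinv, hNU y u hu], ?_⟩
  simp_rw [map_div₀, hsinv]
  rw [← Finset.sum_div, ← hs, div_self hy]

/-- Vanishing of `H²(Γ, M)` for `p`-torsion modules in characteristic `p`. -/
lemma coboundary_of_cocycle {k κ : Type*} [Field k] [Field κ] [Algebra k κ] [IsGalois k κ]
    [IsAlgClosed κ] (p : ℕ) [Fact p.Prime] [CharP κ p]
    {M : Type*} [AddCommGroup M] [Module (ZMod p) M]
    (U : Subgroup (κ ≃ₐ[k] κ)) [U.Normal] (hU : IsOpen (U : Set (κ ≃ₐ[k] κ)))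
    (ρ : (κ ≃ₐ[k] κ) →* (M →ₗ[ZMod p] M)) (hρ : ∀ u ∈ U, ρ u = 1)
    (c : (κ ≃ₐ[k] κ) → (κ ≃ₐ[k] κ) → M)
    (hc : ∀ g h l, c g h + c (g * h) l = ρ g (c h l) + c g (h * l))
    (hc1 : ∀ g h, ∀ u ∈ U, c (g * u) h = c g h) (hc2 : ∀ g h, ∀ u ∈ U, c g (h * u) = c g h) :
    ∃ a : (κ ≃ₐ[k] κ) → M, ∃ W : Subgroup (κ ≃ₐ[k] κ), IsOpen (W : Set (κ ≃ₐ[k] κ)) ∧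
      (∀ u ∈ W, a u = a 1) ∧ ∀ g h, c g h = a g + ρ g (a h) - a (g * h) := by
  classical
  have : Finite ((κ ≃ₐ[k] κ) ⧸ U) := U.quotient_finite_of_isOpen hU
  have := Fintype.ofFinite ((κ ≃ₐ[k] κ) ⧸ U)
  obtain ⟨t, htU, ht1⟩ := exists_trace_one U hU
  let _ : Algebra (ZMod p) κ := ZMod.algebra κ p
  let gl : (κ ≃ₐ[k] κ) → (κ →ₗ[ZMod p] κ) := fun g => (g : κ →+ κ).toZModLinearMap p
  have hgl : ∀ g x, gl g x = g x := fun g x => rfl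
  let T : (κ ≃ₐ[k] κ) → (M ⊗[ZMod p] κ →ₗ[ZMod p] M ⊗[ZMod p] κ) := fun g =>
    TensorProduct.map (ρ g) (gl g)
  have hT : ∀ g h v, T (g * h) v = T g (T h v) := by
    intro g h v
    induction v with
    | zero => simp
    | tmul m x => simp [T, hgl]
    | add a b ha hb => rw [map_add, ha, hb, map_add, map_add]
  let mu : κ → (M ⊗[ZMod p] κ →ₗ[ZMod p] M ⊗[ZMod p] κ) := fun x =>
    LinearMap.lTensor M (LinearMap.mulLeft (ZMod p) x)
  have hmu : ∀ g x v, T g (mu x v) = mu (g x) (T g v) := by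
    intro g x v
    induction v with
    | zero => simp
    | tmul m y => simp [T, mu, hgl]
    | add a b ha hb => rw [map_add, map_add, ha, hb, map_add, map_add]
  have hmu_sum : ∀ (v : M ⊗[ZMod p] κ) (f : (κ ≃ₐ[k] κ) ⧸ U → κ),
      ∑ d, mu (f d) v = mu (∑ d, f d) v := by
    intro v f
    induction v with
    | zero => simp
    | tmul m y => simp [mu, ← TensorProduct.tmul_sum, Finset.sum_mul]
    | add a b ha hb => simp only [map_add, Finset.sum_add_distrib, ha, hb]
  have hmu1 : ∀ v, mu 1 v = v := by
    intro v
    induction v with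
    | zero => simp
    | tmul m y => simp [mu]
    | add a b ha hb => rw [map_add, ha, hb]
  -- the Artin-Schreier map
  let as : κ →ₗ[ZMod p] κ := ((frobenius κ p : κ →+ κ).toZModLinearMap p) - LinearMap.id
  have has : ∀ x, as x = x ^ p - x := fun x => rfl
  have as_surj : Function.Surjective as := by
    intro y
    have hp1 := (Fact.out : p.Prime).one_lt
    have hdeg : (Polynomial.X ^ p - (Polynomial.X + Polynomial.C y) : Polynomial κ).degree = p := by
      rw [Polynomial.degree_sub_eq_left_of_degree_lt]
      · simp
      · rw [Polynomial.degree_X_add_C, Polynomial.degree_X_pow]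
        exact_mod_cast hp1
    obtain ⟨x, hx⟩ := IsAlgClosed.exists_root
      (Polynomial.X ^ p - (Polynomial.X + Polynomial.C y) : Polynomial κ)
      (by rw [hdeg]; exact_mod_cast (by omega : p ≠ 0))
    refine ⟨x, ?_⟩
    rw [has]
    simp only [Polynomial.IsRoot.def, Polynomial.eval_sub, Polynomial.eval_add,
      Polynomial.eval_pow, Polynomial.eval_X, Polynomial.eval_C] at hx
    linear_combination hx
  let inc : ZMod p →ₗ[ZMod p] κ := Algebra.linearMap (ZMod p) κ
  have inc_inj : Function.Injective inc := (algebraMap (ZMod p) κ).injective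
  have hexact : Function.Exact inc as := by
    intro x
    constructor
    · intro hx
      have : x ^ p = x := by rw [has] at hx; exact sub_eq_zero.mp hx
      have h2 : x ∈ (⊥ : Subfield κ) := (Subfield.mem_bot_iff_pow_eq_self κ p).mpr this
      exact (bot_le : (⊥ : Subfield κ) ≤ (algebraMap (ZMod p) κ).fieldRange) h2
    · rintro ⟨z, rfl⟩
      rw [has]
      change algebraMap (ZMod p) κ z ^ p - algebraMap (ZMod p) κ z = 0
      rw [← map_pow, ZMod.pow_card, sub_self]
  let P : M ⊗[ZMod p] κ →ₗ[ZMod p] M ⊗[ZMod p] κ := LinearMap.lTensor M as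
  have P_surj : Function.Surjective P := LinearMap.lTensor_surjective M as_surj
  have P_exact : Function.Exact (LinearMap.lTensor M inc) P := lTensor_exact M hexact as_surj
  have inc_inj' : Function.Injective (LinearMap.lTensor M inc) :=
    Module.Flat.lTensor_preserves_injective_linearMap inc inc_inj
  have hPT : ∀ g v, P (T g v) = T g (P v) := by
    intro g v
    induction v with
    | zero => simp
    | tmul m y => simp [P, T, has, hgl]
    | add a b ha hb => simp only [map_add, ha, hb]
  let j : M → M ⊗[ZMod p] κ := fun m => m ⊗ₜ 1
  have hjadd : ∀ a b, j (a + b) = j a + j b := fun a b => TensorProduct.add_tmul a b 1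
  have hjsub : ∀ a b, j (a - b) = j a - j b := fun a b => TensorProduct.sub_tmul a b 1
  have hj_inj : Function.Injective j := by
    intro a b hab
    have h1 : ∀ m : M, j m = LinearMap.lTensor M inc (m ⊗ₜ 1) := by
      intro m; simp [j, inc]
    rw [h1, h1] at hab
    have := congrArg (TensorProduct.rid (ZMod p) M) (inc_inj' hab)
    simpa using this
  have hPj : ∀ m, P (j m) = 0 := by intro m; simp [P, j, has]
  have hrid : ∀ w : M ⊗[ZMod p] ZMod p,
      j (TensorProduct.rid (ZMod p) M w) = LinearMap.lTensor M inc w := by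
    intro w
    induction w with
    | zero => simp [j]
    | tmul m y => simp [j, inc, TensorProduct.smul_tmul, Algebra.smul_def]
    | add a b ha hb => rw [map_add, map_add, ← ha, ← hb, hjadd]
  have hPker : ∀ v, P v = 0 → ∃ m, j m = v := by
    intro v hv
    obtain ⟨w, rfl⟩ := (P_exact v).mp hv
    exact ⟨_, hrid w⟩
  have hTj : ∀ g m, T g (j m) = j (ρ g m) := by intro g m; simp [T, j, hgl]
  -- translation of coset sums
  have hout : ∀ (g : κ ≃ₐ[k] κ) (d : (κ ≃ₐ[k] κ) ⧸ U), ∃ u ∈ U,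
      g * d.out = ((g : (κ ≃ₐ[k] κ) ⧸ U) * d).out * u := by
    intro g d
    refine ⟨(((g : (κ ≃ₐ[k] κ) ⧸ U) * d).out)⁻¹ * (g * d.out), ?_, by group⟩
    rw [← QuotientGroup.eq]
    simp
  have hreindex : ∀ (g : κ ≃ₐ[k] κ) (f : (κ ≃ₐ[k] κ) → M ⊗[ZMod p] κ),
      (∀ h, ∀ u ∈ U, f (h * u) = f h) →
      ∑ d : (κ ≃ₐ[k] κ) ⧸ U, f (g * d.out) = ∑ d : (κ ≃ₐ[k] κ) ⧸ U, f d.out := by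
    intro g f hf
    rw [← Equiv.sum_comp (Equiv.mulLeft (g : (κ ≃ₐ[k] κ) ⧸ U)) (fun d => f d.out)]
    refine Finset.sum_congr rfl fun d _ => ?_
    obtain ⟨u, hu, h⟩ := hout g d
    rw [h, hf _ u hu]
    rfl
  have ht_sum : ∀ g : κ ≃ₐ[k] κ, ∑ d : (κ ≃ₐ[k] κ) ⧸ U, g (d.out t) = 1 := by
    intro g
    rw [← map_sum, ht1, map_one]
  let b : (κ ≃ₐ[k] κ) → M ⊗[ZMod p] κ := fun g =>
    ∑ d : (κ ≃ₐ[k] κ) ⧸ U, c g d.out ⊗ₜ[ZMod p] ((g * d.out) t)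
  have hb : ∀ g h, T g (b h) = j (c g h) + b (g * h) - b g := by
    intro g h
    have e1 : b g = ∑ d : (κ ≃ₐ[k] κ) ⧸ U, c g (h * d.out) ⊗ₜ[ZMod p] ((g * (h * d.out)) t) := by
      rw [hreindex h (fun x => c g x ⊗ₜ[ZMod p] ((g * x) t))]
      intro x u hu
      simp only [hc2 g x u hu, AlgEquiv.mul_apply, htU u hu]
    have e2 : j (c g h) = ∑ d : (κ ≃ₐ[k] κ) ⧸ U, c g h ⊗ₜ[ZMod p] ((g * (h * d.out)) t) := by
      rw [← TensorProduct.tmul_sum]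
      have := ht_sum (g * h)
      simp only [AlgEquiv.mul_apply] at this ⊢
      rw [this]
    rw [e1, e2, ← Finset.sum_add_distrib, ← Finset.sum_sub_distrib, map_sum]
    refine Finset.sum_congr rfl fun d _ => ?_
    rw [mul_assoc, ← TensorProduct.add_tmul, ← TensorProduct.sub_tmul, hc g h d.out]
    simp [T, hgl]
  have hbU : ∀ g, ∀ u ∈ U, b (g * u) = b g := by
    intro g u hu
    refine Finset.sum_congr rfl fun d _ => ?_
    have h1 : (d.out : κ ≃ₐ[k] κ)⁻¹ * u * d.out ∈ U := by
      have := ‹U.Normal›.conj_mem u hu (d.out : κ ≃ₐ[k] κ)⁻¹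
      simpa using this
    have h2 : g * u * d.out = g * d.out * ((d.out : κ ≃ₐ[k] κ)⁻¹ * u * d.out) := by group
    rw [hc1 g _ u hu, h2, AlgEquiv.mul_apply (g * d.out), htU _ h1]
  let z : (κ ≃ₐ[k] κ) → M ⊗[ZMod p] κ := fun g => P (b g)
  have hz : ∀ g h, T g (z h) = z (g * h) - z g := by
    intro g h
    simp only [z]
    rw [← hPT, hb, map_sub, map_add, hPj, zero_add]
  let w : M ⊗[ZMod p] κ := ∑ d : (κ ≃ₐ[k] κ) ⧸ U, mu (d.out t) (z d.out)
  have hw : ∀ g, T g w = w - z g := by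
    intro g
    have e1 : w = ∑ d : (κ ≃ₐ[k] κ) ⧸ U, mu ((g * d.out) t) (z (g * d.out)) := by
      rw [hreindex g (fun x => mu (x t) (z x))]
      intro x u hu
      simp only [z, hbU x u hu, AlgEquiv.mul_apply, htU u hu]
    have e2 : z g = ∑ d : (κ ≃ₐ[k] κ) ⧸ U, mu ((g * d.out) t) (z g) := by
      rw [hmu_sum]
      simp only [AlgEquiv.mul_apply]
      rw [ht_sum, hmu1]
    rw [e2]
    conv_rhs => rw [e1]
    rw [← Finset.sum_sub_distrib]
    simp only [w]
    rw [map_sum]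
    refine Finset.sum_congr rfl fun d _ => ?_
    rw [hmu, hz, map_sub]
    rfl
  obtain ⟨w', hw'⟩ := P_surj w
  have hex : ∀ g, ∃ m, j m = b g - w' + T g w' := by
    intro g
    apply hPker
    rw [map_add, map_sub, hPT, hw', hw]
    simp [z]
  choose a ha using hex
  -- smoothness
  have hsm : ∀ v : M ⊗[ZMod p] κ, ∃ W : Subgroup (κ ≃ₐ[k] κ), IsOpen (W : Set (κ ≃ₐ[k] κ)) ∧
      ∀ g ∈ W, T g v = v := by
    intro v
    induction v with
    | zero => exact ⟨⊤, isOpen_univ, by simp⟩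
    | tmul m y =>
      refine ⟨U ⊓ (IntermediateField.adjoin k {y}).fixingSubgroup, ?_, ?_⟩
      · have : FiniteDimensional k (IntermediateField.adjoin k {y}) :=
          IntermediateField.adjoin.finiteDimensional (Algebra.IsIntegral.isIntegral y)
        exact hU.inter (IntermediateField.fixingSubgroup_isOpen _)
      · intro g hg
        have := (IntermediateField.mem_fixingSubgroup_iff _ _).mp hg.2 y
          (IntermediateField.mem_adjoin_simple_self k y)
        simp [T, hρ g hg.1, hgl, this]
    | add v1 v2 h1 h2 =>
      obtain ⟨W1, ho1, h1⟩ := h1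
      obtain ⟨W2, ho2, h2⟩ := h2
      refine ⟨W1 ⊓ W2, ho1.inter ho2, fun g hg => ?_⟩
      rw [map_add, h1 g hg.1, h2 g hg.2]
  obtain ⟨W, hWo, hW⟩ := hsm w'
  refine ⟨a, U ⊓ W, hU.inter hWo, ?_, ?_⟩
  · intro u hu
    apply hj_inj
    rw [ha, ha, hW u hu.2, hW 1 W.one_mem, ← hbU 1 u hu.1, one_mul]
  · intro g h
    apply hj_inj
    rw [hjsub, hjadd, ← hTj, ha, ha, ha, map_add, map_sub, hb, hT]
    abel

/-- Embedding problems with elementary abelian `p`-kernel are weakly solvable in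
characteristic `p`. -/
lemma embed_abelian {k κ : Type*} [Field k] [Field κ] [Algebra k κ] [IsGalois k κ]
    [IsAlgClosed κ] (p : ℕ) [Fact p.Prime] [CharP κ p]
    {E Q : Type*} [Group E] [Group Q] (π : E →* Q) (hπ : Function.Surjective π)
    (hcomm : ∀ x ∈ π.ker, ∀ y ∈ π.ker, x * y = y * x) (hexp : ∀ x ∈ π.ker, x ^ p = 1)
    (α : (κ ≃ₐ[k] κ) →* Q) (hα : IsOpen (α.ker : Set (κ ≃ₐ[k] κ))) :
    ∃ β : (κ ≃ₐ[k] κ) →* E, IsOpen (β.ker : Set (κ ≃ₐ[k] κ)) ∧ π.comp β = α := by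
  classical
  obtain ⟨M, _, _, ⟨j⟩⟩ : ∃ (M : Type _) (_ : AddCommGroup M) (_ : Module (ZMod p) M),
      Nonempty (M ≃+ Additive π.ker) := by
    let instC : CommGroup π.ker :=
      { (inferInstance : Group π.ker) with
        mul_comm := fun x y => Subtype.ext (hcomm x x.2 y y.2) }
    exact ⟨Additive π.ker, inferInstance, AddCommGroup.zmodModule (n := p) (by
      intro x
      exact congrArg Additive.ofMul (Subtype.ext (hexp _ (Additive.toMul x).2) :
        (Additive.toMul x) ^ p = 1)), ⟨AddEquiv.refl _⟩⟩
  let s : Q → E := Function.surjInv hπ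
  have hs : ∀ q, π (s q) = q := Function.surjInv_eq hπ
  let f : (κ ≃ₐ[k] κ) → E := fun g => s (α g)
  have hf : ∀ g, π (f g) = α g := fun g => hs _
  have hfU : ∀ g, ∀ u ∈ α.ker, f (g * u) = f g := by
    intro g u hu
    have : α u = 1 := hu
    simp [f, this]
  -- conjugation
  let cj : E → (π.ker →* π.ker) := fun e => (MulAut.conjNormal e : π.ker ≃* π.ker).toMonoidHom
  have hcj : ∀ e x, ((cj e x : π.ker) : E) = e * x * e⁻¹ := fun e x => rfl
  have hcj_ker : ∀ e ∈ π.ker, ∀ x, cj e x = x := by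
    intro e he x
    apply Subtype.ext
    rw [hcj, hcomm e he x x.2, mul_inv_cancel_right]
  have hcj_mul : ∀ e e' x, cj (e * e') x = cj e (cj e' x) := by
    intro e e' x
    apply Subtype.ext
    change e * e' * (x : E) * (e * e')⁻¹ = e * (e' * x * e'⁻¹) * e⁻¹
    group
  have hcj_eq : ∀ e e', π e = π e' → ∀ x, cj e x = cj e' x := by
    intro e e' h x
    have h1 : e = e' * (e'⁻¹ * e) := by group
    rw [h1, hcj_mul, hcj_ker (e'⁻¹ * e)]
    simp [MonoidHom.mem_ker, h]
  let r : (κ ≃ₐ[k] κ) → Module.End (ZMod p) M :=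
    fun g => ((j.symm.toAddMonoidHom.comp (cj (f g)).toAdditive).comp
      j.toAddMonoidHom).toZModLinearMap p
  have hrj : ∀ g x, j (r g x) = Additive.ofMul (cj (f g) (j x).toMul) := fun g x =>
    j.apply_symm_apply _
  have hr1 : r 1 = 1 := by
    refine LinearMap.ext fun x => j.injective ?_
    rw [hrj]
    exact hcj_ker (f 1) (by simp [MonoidHom.mem_ker, hf]) (j x).toMul
  have hrm : ∀ g h, r (g * h) = r g * r h := by
    intro g h
    refine LinearMap.ext fun x => j.injective ?_
    rw [Module.End.mul_apply, hrj, hrj, hrj]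
    exact ((hcj_eq (f (g * h)) (f g * f h) (by simp [hf])) (j x).toMul).trans (hcj_mul _ _ _)
  let ρ : (κ ≃ₐ[k] κ) →* Module.End (ZMod p) M := ⟨⟨r, hr1⟩, hrm⟩
  let c0 : (κ ≃ₐ[k] κ) → (κ ≃ₐ[k] κ) → π.ker := fun g h =>
    ⟨f g * f h * (f (g * h))⁻¹, by simp [MonoidHom.mem_ker, hf]⟩
  have hρU : ∀ u ∈ α.ker, ρ u = 1 := by
    intro u hu
    refine LinearMap.ext fun x => j.injective ?_
    change j (r u x) = j x
    rw [hrj]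
    exact hcj_ker (f u) (by rw [MonoidHom.mem_ker, hf]; exact hu) (j x).toMul
  have hcc : ∀ g h l, j.symm (Additive.ofMul (c0 g h)) + j.symm (Additive.ofMul (c0 (g * h) l)) =
      ρ g (j.symm (Additive.ofMul (c0 h l))) + j.symm (Additive.ofMul (c0 g (h * l))) := by
    intro g h l
    apply j.injective
    change j _ = j (r g _ + _)
    rw [map_add, map_add, hrj]
    simp only [AddEquiv.apply_symm_apply]
    refine congrArg Additive.ofMul (?_ : c0 g h * c0 (g * h) l = cj (f g) (c0 h l) * c0 g (h * l))
    apply Subtype.ext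
    change f g * f h * (f (g * h))⁻¹ * (f (g * h) * f l * (f (g * h * l))⁻¹) =
      f g * (f h * f l * (f (h * l))⁻¹) * (f g)⁻¹ * (f g * f (h * l) * (f (g * (h * l)))⁻¹)
    rw [mul_assoc g h l]
    group
  obtain ⟨a, W, hW, haW, hac⟩ := coboundary_of_cocycle (M := M) p α.ker hα ρ hρU
    (fun g h => j.symm (Additive.ofMul (c0 g h))) hcc (by
      intro g h u hu
      refine congrArg (fun z => j.symm (Additive.ofMul z)) (Subtype.ext ?_)
      have h2 : g * u * h = g * h * (h⁻¹ * u * h) := by group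
      have h3 : h⁻¹ * u * h ∈ α.ker := by
        simpa using (inferInstance : α.ker.Normal).conj_mem u hu h⁻¹
      simp only [c0, hfU g u hu, h2, hfU _ _ h3]) (by
      intro g h u hu
      refine congrArg (fun z => j.symm (Additive.ofMul z)) (Subtype.ext ?_)
      simp only [c0, hfU h u hu, ← mul_assoc, hfU _ u hu])
  let a' : (κ ≃ₐ[k] κ) → π.ker := fun g => (j (a g)).toMul
  have hac' : ∀ g h, c0 g h * a' (g * h) = a' g * cj (f g) (a' h) := by
    intro g h
    have := hac g h
    rw [eq_sub_iff_add_eq] at this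
    have h2 := congrArg j this
    rw [map_add, map_add, AddEquiv.apply_symm_apply] at h2
    change _ = _ + j (r g _) at h2
    rw [hrj] at h2
    exact congrArg Additive.toMul h2
  have hac'' : ∀ g h, f g * f h * (f (g * h))⁻¹ * (a' (g * h) : E)
      = (a' g : E) * (f g * (a' h : E) * (f g)⁻¹) := by
    intro g h
    exact congrArg Subtype.val (hac' g h)
  have hkf : ∀ g h, f g * f h * (f (g * h))⁻¹ ∈ π.ker := fun g h => (c0 g h).2
  have hmul : ∀ g h, (a' (g * h) : E)⁻¹ * f (g * h) = ((a' g : E)⁻¹ * f g) * ((a' h : E)⁻¹ * f h) := by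
    intro g h
    have h1 := hac'' g h
    have h3 : (f g * (a' h : E) * (f g)⁻¹) ∈ π.ker := (cj (f g) (a' h)).2
    have h4 := hcomm _ (a' g).2 _ h3
    have h5 := hcomm _ (hkf g h) _ (a' (g * h)).2
    rw [h5, h4] at h1
    have h6 : (a' (g * h) : E)⁻¹ =
        (f g * f h * (f (g * h))⁻¹) * ((f g * (a' h : E) * (f g)⁻¹) * (a' g : E))⁻¹ := by
      rw [← h1]; group
    have h7 : (f g * f h * (f (g * h))⁻¹) * ((f g * (a' h : E) * (f g)⁻¹) * (a' g : E))⁻¹ =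
        ((f g * (a' h : E) * (f g)⁻¹) * (a' g : E))⁻¹ * (f g * f h * (f (g * h))⁻¹) :=
      hcomm _ (hkf g h) _ (inv_mem (mul_mem h3 (a' g).2))
    rw [h6, h7]
    group
  let β : (κ ≃ₐ[k] κ) →* E := MonoidHom.mk' (fun g => (a' g : E)⁻¹ * f g) hmul
  have hβ : ∀ g, β g = (a' g : E)⁻¹ * f g := fun g => rfl
  refine ⟨β, ?_, ?_⟩
  · refine Subgroup.isOpen_mono (H₁ := W ⊓ α.ker) ?_ (hW.inter hα)
    intro u hu
    rw [MonoidHom.mem_ker, ← map_one β, hβ, hβ]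
    have h1 : a' u = a' 1 := congrArg (fun z => (j z).toMul) (haW u hu.1)
    have h2 : f u = f 1 := by have := hfU 1 u hu.2; rwa [one_mul] at this
    rw [h1, h2]
  · ext g
    have : π (a' g : E) = 1 := (a' g).2
    simp [hβ, hf, this]

/-- Embedding problems with `p`-kernel are weakly solvable in characteristic `p`. -/
lemma embed_pgroup {k κ : Type*} [Field k] [Field κ] [Algebra k κ] [IsGalois k κ]
    [IsAlgClosed κ] (p : ℕ) [Fact p.Prime] [CharP κ p] (n : ℕ) :
    ∀ {E Q : Type} [Group E] [Finite E] [Group Q] (π : E →* Q) (_ : Function.Surjective π)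
    (_ : IsPGroup p π.ker) (_ : Nat.card E = n)
    (α : (κ ≃ₐ[k] κ) →* Q) (_ : IsOpen (α.ker : Set (κ ≃ₐ[k] κ))),
    ∃ β : (κ ≃ₐ[k] κ) →* E, IsOpen (β.ker : Set (κ ≃ₐ[k] κ)) ∧ π.comp β = α := by
  induction n using Nat.strong_induction_on with
  | _ n ih =>
  intro E Q _ _ _ π hπ hker hcard α hα
  by_cases htriv : π.ker = ⊥
  · let e : E ≃* Q := MulEquiv.ofBijective π ⟨(MonoidHom.ker_eq_bot_iff π).mp htriv, hπ⟩
    refine ⟨e.symm.toMonoidHom.comp α, ?_, ?_⟩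
    · convert hα using 2
      ext g
      simp [MonoidHom.mem_ker]
    · ext g
      exact e.apply_symm_apply (α g)
  -- the elementary abelian normal subgroup
  let A : Subgroup E :=
    { carrier := {x | x ∈ π.ker ∧ (∀ y ∈ π.ker, x * y = y * x) ∧ x ^ p = 1}
      mul_mem' := by
        rintro x y ⟨hx1, hx2, hx3⟩ ⟨hy1, hy2, hy3⟩
        refine ⟨mul_mem hx1 hy1, fun z hz => ?_, ?_⟩
        · rw [mul_assoc, hy2 z hz, ← mul_assoc, hx2 z hz, mul_assoc]
        · rw [Commute.mul_pow (hx2 y hy1), hx3, hy3, one_mul]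
      one_mem' := ⟨one_mem _, by simp, by simp⟩
      inv_mem' := by
        rintro x ⟨hx1, hx2, hx3⟩
        refine ⟨inv_mem hx1, fun z hz => ?_, by rw [inv_pow, hx3, inv_one]⟩
        exact (Commute.inv_left (hx2 z hz)) }
  have hAmem : ∀ x, x ∈ A ↔ x ∈ π.ker ∧ (∀ y ∈ π.ker, x * y = y * x) ∧ x ^ p = 1 := fun x => Iff.rfl
  have hAn : A.Normal := by
    constructor
    rintro x ⟨hx1, hx2, hx3⟩ g
    refine ⟨(inferInstance : π.ker.Normal).conj_mem x hx1 g, fun y hy => ?_, ?_⟩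
    · have := hx2 (g⁻¹ * y * g) (by simpa using (inferInstance : π.ker.Normal).conj_mem y hy g⁻¹)
      calc g * x * g⁻¹ * y = g * (x * (g⁻¹ * y * g)) * g⁻¹ := by group
        _ = g * ((g⁻¹ * y * g) * x) * g⁻¹ := by rw [this]
        _ = _ := by group
    · rw [conj_pow, hx3]; group
  have hAne : A ≠ ⊥ := by
    have : Nontrivial π.ker := (Subgroup.nontrivial_iff_ne_bot _).mpr htriv
    have hcn : Nontrivial (Subgroup.center π.ker) := hker.center_nontrivial
    have hcp : IsPGroup p (Subgroup.center π.ker) := hker.to_subgroup _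
    have hdvd : p ∣ Nat.card (Subgroup.center π.ker) := by
      obtain ⟨m, hm0, hm⟩ := hcp.nontrivial_iff_card.mp hcn
      rw [hm]
      exact dvd_pow_self p hm0.ne'
    obtain ⟨x, hx⟩ := exists_prime_orderOf_dvd_card' p hdvd
    intro hbot
    have hxA : ((x : π.ker) : E) ∈ A := by
      refine ⟨(x : π.ker).2, fun y hy => ?_, ?_⟩
      · exact congrArg Subtype.val (Subgroup.mem_center_iff.mp x.2 ⟨y, hy⟩).symm
      · have := pow_orderOf_eq_one x
        rw [hx] at this
        exact congrArg (fun z : Subgroup.center π.ker => ((z : π.ker) : E)) this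
    rw [hbot, Subgroup.mem_bot] at hxA
    have : x = 1 := by ext; exact hxA
    rw [this, orderOf_one] at hx
    exact (Fact.out : p.Prime).one_lt.ne hx
  have hAk : A ≤ π.ker := fun x hx => hx.1
  let π' : E ⧸ A →* Q := QuotientGroup.lift A π hAk
  have hπ' : Function.Surjective π' := by
    intro q
    obtain ⟨e, rfl⟩ := hπ q
    exact ⟨(e : E ⧸ A), rfl⟩
  have hlt : Nat.card (E ⧸ A) < n := by
    rw [← hcard, Subgroup.card_eq_card_quotient_mul_card_subgroup A]
    have h1 : 1 < Nat.card A := by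
      have := (Subgroup.nontrivial_iff_ne_bot A).mpr hAne
      exact Finite.one_lt_card
    have h2 : 0 < Nat.card (E ⧸ A) := Nat.card_pos
    nlinarith
  have hker' : IsPGroup p π'.ker := by
    intro ⟨x, hx⟩
    obtain ⟨e, rfl⟩ := QuotientGroup.mk_surjective x
    have he : e ∈ π.ker := hx
    obtain ⟨m, hm⟩ := hker ⟨e, he⟩
    refine ⟨m, Subtype.ext ?_⟩
    have : e ^ p ^ m = 1 := congrArg Subtype.val hm
    change (e : E ⧸ A) ^ p ^ m = 1
    rw [← QuotientGroup.mk_pow, this, QuotientGroup.mk_one]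
  obtain ⟨β', hβ', hβ'α⟩ := ih _ hlt π' hπ' hker' rfl α hα
  obtain ⟨β, hβ, hββ'⟩ := embed_abelian p (QuotientGroup.mk' A) (QuotientGroup.mk'_surjective A)
    (by
      intro x hx y hy
      rw [QuotientGroup.ker_mk'] at hx hy
      exact hx.2.1 y hy.1)
    (by
      intro x hx
      rw [QuotientGroup.ker_mk'] at hx
      exact hx.2.2) β' hβ'
  refine ⟨β, hβ, ?_⟩
  rw [← hβ'α, ← hββ']
  ext g
  rfl

end

/-- A nonzero polynomial over a field with a valuation ring can be scaled to be integral with some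
unit coefficient. -/
lemma prim_poly {F : Type*} [Field F] (V : ValuationSubring F) (p : Polynomial F) (hp : p ≠ 0) :
    ∃ q : Polynomial V, (∃ n, IsUnit (q.coeff n)) ∧ ∃ c : F, c ≠ 0 ∧
      q.map (algebraMap V F) = Polynomial.C c * p := by
  classical
  obtain ⟨n, hn, hmax⟩ := Finset.exists_max_image p.support (fun i => V.valuation (p.coeff i))
    (Polynomial.support_nonempty.mpr hp)
  have hn0 : p.coeff n ≠ 0 := Polynomial.mem_support_iff.mp hn
  have hc : ∀ i, (p.coeff n)⁻¹ * p.coeff i ∈ V := by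
    intro i
    by_cases hi : i ∈ p.support
    · rw [← V.valuation_le_one_iff, map_mul, map_inv₀]
      have h0 : 0 < V.valuation (p.coeff n) := by
        rw [zero_lt_iff]; simpa using hn0
      rw [inv_mul_le_iff₀ h0, mul_one]
      exact hmax i hi
    · rw [Polynomial.notMem_support_iff.mp hi, mul_zero]; exact V.zero_mem
  have hl : Polynomial.C (p.coeff n)⁻¹ * p ∈ Polynomial.lifts (algebraMap V F) := by
    rw [Polynomial.lifts_iff_coeff_lifts]
    intro i
    rw [Polynomial.coeff_C_mul]
    exact ⟨⟨_, hc i⟩, rfl⟩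
  obtain ⟨q, hq⟩ := (Polynomial.mem_lifts _).mp hl
  refine ⟨q, ⟨n, ?_⟩, (p.coeff n)⁻¹, inv_ne_zero hn0, hq⟩
  have h1 : algebraMap V F (q.coeff n) = 1 := by
    rw [← Polynomial.coeff_map, hq, Polynomial.coeff_C_mul, inv_mul_cancel₀ hn0]
  have : q.coeff n = 1 := Subtype.ext h1
  rw [this]; exact isUnit_one

/-- Extension of places to algebraic extensions. -/
lemma exists_place {F Ω κ : Type*} [Field F] [Field Ω] [Field κ] [Algebra F Ω]
    [Algebra.IsAlgebraic F Ω] [IsAlgClosed κ] (V : ValuationSubring F) (ψ : V →+* κ)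
    (hψ : IsLocalHom ψ) :
    ∃ (O : ValuationSubring Ω) (φ : O →+* κ), IsLocalHom φ ∧
      (∀ x : F, algebraMap F Ω x ∈ O ↔ x ∈ V) ∧
      ∀ (x : V) (hx : algebraMap F Ω x ∈ O), φ ⟨algebraMap F Ω x, hx⟩ = ψ x := by
  obtain ⟨O, hO1, hO2⟩ := (LocalSubring.map (algebraMap F Ω)
    V.toLocalSubring).exists_le_valuationSubring
  have hVO : ∀ x : F, x ∈ V → algebraMap F Ω x ∈ O := fun x hx => hO1 ⟨x, hx, rfl⟩
  let θ : V →+* O := ((algebraMap F Ω).comp (algebraMap V F)).codRestrict O.toSubring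
    (fun x => hVO x x.2)
  have hθ : ∀ x, (θ x : Ω) = algebraMap F Ω x := fun x => rfl
  have hθl : IsLocalHom θ := by
    constructor
    intro a ha
    have h1 : IsUnit (Subring.inclusion hO1 ⟨algebraMap F Ω a, ⟨a, a.2, rfl⟩⟩) := ha
    have h2 := hO2.1 _ h1
    obtain ⟨⟨_, c, hc, rfl⟩, hb⟩ := isUnit_iff_exists_inv.mp h2
    have h3 : algebraMap F Ω a * algebraMap F Ω c = 1 := congrArg Subtype.val hb
    rw [← map_mul, ← map_one (algebraMap F Ω)] at h3
    have h4 := (algebraMap F Ω).injective h3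
    exact isUnit_iff_exists_inv.mpr ⟨⟨c, hc⟩, Subtype.ext h4⟩
  have hOV : ∀ x : F, algebraMap F Ω x ∈ O ↔ x ∈ V := by
    intro x
    refine ⟨fun hx => ?_, hVO x⟩
    by_contra hxV
    have hx0 : x ≠ 0 := by rintro rfl; exact hxV V.zero_mem
    have hinv : x⁻¹ ∈ V := (V.mem_or_inv_mem x).resolve_left hxV
    have h1 : IsUnit (θ ⟨x⁻¹, hinv⟩) := isUnit_iff_exists_inv.mpr
      ⟨⟨_, hx⟩, Subtype.ext (by
        change algebraMap F Ω x⁻¹ * algebraMap F Ω x = 1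
        rw [← map_mul, inv_mul_cancel₀ hx0, map_one])⟩
    have h2 := hθl.1 _ h1
    obtain ⟨c, hc⟩ := isUnit_iff_exists_inv.mp h2
    have h3 : x⁻¹ * (c : F) = 1 := congrArg Subtype.val hc
    have : (c : F) = x := by
      field_simp at h3; exact h3
    exact hxV (this ▸ c.2)
  let _ : Algebra (IsLocalRing.ResidueField V) κ := (IsLocalRing.ResidueField.lift ψ).toAlgebra
  let _ : Algebra (IsLocalRing.ResidueField V) (IsLocalRing.ResidueField O) :=
    (IsLocalRing.ResidueField.map θ).toAlgebra
  have halg : Algebra.IsAlgebraic (IsLocalRing.ResidueField V) (IsLocalRing.ResidueField O) := by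
    constructor
    intro y
    obtain ⟨x, rfl⟩ := IsLocalRing.residue_surjective y
    obtain ⟨p, hp0, hp⟩ := Algebra.IsAlgebraic.isAlgebraic (R := F) (x : Ω)
    obtain ⟨q, ⟨n, hn⟩, c, hc, hq⟩ := prim_poly V p hp0
    refine ⟨q.map (IsLocalRing.residue V), ?_, ?_⟩
    · intro h0
      have := congrArg (fun r => r.coeff n) h0
      simp only [Polynomial.coeff_map, Polynomial.coeff_zero, IsLocalRing.residue_eq_zero_iff] at this
      exact this hn
    · have h1 : q.eval₂ θ x = 0 := by
        apply Subtype.ext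
        have h2 : O.subtype (q.eval₂ θ x) = q.eval₂ ((algebraMap F Ω).comp (algebraMap V F)) (x : Ω) := by
          rw [Polynomial.hom_eval₂]; rfl
        refine h2.trans ?_
        rw [← Polynomial.eval₂_map, hq, Polynomial.eval₂_mul]
        change _ * Polynomial.aeval (x : Ω) p = _
        rw [hp, mul_zero]; rfl
      have h2 := congrArg (IsLocalRing.residue O) h1
      rw [Polynomial.hom_eval₂, map_zero] at h2
      rw [Polynomial.aeval_def, Polynomial.eval₂_map]
      exact h2
  let l : IsLocalRing.ResidueField O →ₐ[IsLocalRing.ResidueField V] κ := IsAlgClosed.lift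
  refine ⟨O, l.toRingHom.comp (IsLocalRing.residue O), ?_, hOV, ?_⟩
  · exact RingHom.isLocalHom_comp _ _
  · intro x hx
    exact l.commutes (IsLocalRing.residue V x)


/-- The elements of `M` which are `O`-integral have residues in `k`. -/
def ResIn (k : Type*) {Ω κ : Type*} [Field k] [Field Ω] [Field κ] [Algebra k κ]
    (O : ValuationSubring Ω) (φ : O →+* κ) (M : Set Ω) : Prop :=
  ∀ x ∈ M, ∀ hx : x ∈ O, φ ⟨x, hx⟩ ∈ (algebraMap k κ).range

lemma exists_max_res {F Ω k κ : Type*} [Field F] [Field Ω] [Field k] [Field κ] [Algebra F Ω]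
    [Algebra k κ] (O : ValuationSubring Ω) (φ : O →+* κ)
    (hF : ResIn k O φ (Set.range (algebraMap F Ω))) :
    ∃ L : IntermediateField F Ω, ResIn k O φ (L : Set Ω) ∧
      ∀ M : IntermediateField L Ω, ResIn k O φ (M : Set Ω) → M = ⊥ := by
  obtain ⟨L, -, hL⟩ := zorn_le_nonempty₀ {L : IntermediateField F Ω | ResIn k O φ (L : Set Ω)}
    (by
      intro c hc hchain y hy
      have : Nonempty c := ⟨⟨y, hy⟩⟩
      refine ⟨⨆ i : c, (i : IntermediateField F Ω), ?_, fun z hz =>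
        le_iSup (fun i : c => (i : IntermediateField F Ω)) ⟨z, hz⟩⟩
      intro x hx hxO
      rw [IntermediateField.coe_iSup_of_directed hchain.directed] at hx
      obtain ⟨i, hi⟩ := Set.mem_iUnion.mp hx
      exact hc i.2 x hi hxO) ⊥ (by
      intro x hx hxO
      exact hF x (IntermediateField.mem_bot.mp hx) hxO)
  refine ⟨L, hL.prop, fun M hM => ?_⟩
  have h1 : L ≤ M.restrictScalars F := by
    intro x hx
    exact M.algebraMap_mem ⟨x, hx⟩
  have h2 := hL.le_of_ge (y := M.restrictScalars F) hM h1
  rw [eq_bot_iff]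
  intro x hx
  exact IntermediateField.mem_bot.mpr ⟨⟨x, h2 hx⟩, rfl⟩

lemma valuation_sum_ge {Ω Γ ι : Type*} [Field Ω] [LinearOrderedCommGroupWithZero Γ]
    (v : Valuation Ω Γ) (s : Finset ι) (f : ι → Ω)
    (h : ∀ i ∈ s, ∀ j ∈ s, i ≠ j → f i ≠ 0 → v (f i) ≠ v (f j)) :
    ∀ i ∈ s, v (f i) ≤ v (∑ j ∈ s, f j) := by
  classical
  intro i hi
  obtain ⟨m, hm, hmax⟩ := Finset.exists_max_image s (fun i => v (f i)) ⟨i, hi⟩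
  refine (hmax i hi).trans (le_of_eq ?_)
  by_cases h0 : f m = 0
  · have : ∀ j ∈ s, f j = 0 := by
      intro j hj
      have := hmax j hj
      simp only [h0, map_zero, le_zero_iff] at this
      simpa using this
    rw [Finset.sum_eq_zero this, h0]
  · rw [← Finset.add_sum_erase s f hm, Valuation.map_add_eq_of_lt_left]
    refine Valuation.map_sum_lt v (by simpa using h0) ?_
    intro j hj
    have hj' := Finset.mem_erase.mp hj
    exact lt_of_le_of_ne (hmax j hj'.2) (h m hm j hj'.2 hj'.1.symm h0).symm

lemma value_quot {L Ω Γ : Type*} [Field L] [Field Ω] [Algebra L Ω]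
    [LinearOrderedCommGroupWithZero Γ] (v : Valuation Ω Γ) (x : Ω) (hx0 : x ≠ 0) (c d : L)
    (hd : d ≠ 0) (i j : ℕ) (hij : i < j)
    (heq : v (algebraMap L Ω c * x ^ i) = v (algebraMap L Ω d * x ^ j)) :
    v (algebraMap L Ω (c / d)) = v x ^ (j - i) := by
  have hvx : v x ≠ 0 := by simpa using hx0
  have hvj : v (algebraMap L Ω d) ≠ 0 := by simpa using hd
  obtain ⟨e, rfl⟩ := Nat.exists_eq_add_of_lt hij
  rw [map_div₀, map_div₀, div_eq_iff hvj]
  have : i + e + 1 - i = e + 1 := by omega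
  rw [this]
  simp only [map_mul, map_pow] at heq
  have h3 : v x ^ (i + e + 1) = v x ^ (e + 1) * v x ^ i := by
    rw [← pow_add]; congr 1; omega
  rw [h3, ← mul_assoc] at heq
  have := mul_right_cancel₀ (pow_ne_zero i hvx) heq
  rw [this, mul_comm]

section
variable {L Ω k κ : Type*} [Field L] [Field Ω] [Field k] [Field κ] [Algebra L Ω]
    [Algebra k κ] [IsAlgClosed Ω] [Algebra.IsAlgebraic L Ω] [PerfectField k]

lemma perfect_of_max (O : ValuationSubring Ω) (φ : O →+* κ)
    (hL : ResIn k O φ (Set.range (algebraMap L Ω)))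
    (hmax : ∀ M : IntermediateField L Ω, ResIn k O φ (M : Set Ω) → M = ⊥) : PerfectField L := by
  obtain ⟨p, hp⟩ := ExpChar.exists L
  cases hp with
  | zero => infer_instance
  | prime hp =>
  have : Fact p.Prime := ⟨hp⟩
  have : CharP Ω p := charP_of_injective_algebraMap (algebraMap L Ω).injective p
  have : CharP O p := ⟨fun n => by
    rw [← CharP.cast_eq_zero_iff Ω p n, ← Subtype.coe_inj]; rfl⟩
  have : CharP κ p := by
    have hz : (p : κ) = 0 := by
      rw [← map_natCast φ p, CharP.cast_eq_zero, map_zero]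
    exact (CharP.charP_iff_prime_eq_zero hp).mpr hz
  have : CharP k p := (RingHom.charP_iff (algebraMap k κ) (algebraMap k κ).injective p).mpr this
  have : ExpChar L p := ExpChar.prime hp
  have : ExpChar k p := ExpChar.prime hp
  have : ExpChar κ p := ExpChar.prime hp
  have hb : perfectClosure L Ω = ⊥ := by
    apply hmax
    intro x hx hxO
    obtain ⟨n, y, hy⟩ := (mem_perfectClosure_iff_pow_mem p).mp hx
    have h1 : x ^ p ^ n ∈ O := pow_mem hxO _
    obtain ⟨c, hc⟩ := hL (x ^ p ^ n) ⟨y, hy⟩ h1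
    obtain ⟨d, hd⟩ := (bijective_iterateFrobenius k p n).2 c
    refine ⟨d, ?_⟩
    have h2 : φ ⟨x ^ p ^ n, h1⟩ = φ ⟨x, hxO⟩ ^ p ^ n := by rw [← map_pow]; rfl
    rw [h2, ← hd, iterateFrobenius_def, map_pow] at hc
    exact iterateFrobenius_inj κ p n (by simpa [iterateFrobenius_def] using hc)
  have : PerfectRing L p := by
    refine PerfectRing.ofSurjective L p fun a => ?_
    obtain ⟨y, hy⟩ := IsAlgClosed.exists_pow_nat_eq (algebraMap L Ω a) hp.pos
    have hyb : y ∈ perfectClosure L Ω :=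
      (mem_perfectClosure_iff_pow_mem p).mpr ⟨1, a, by rw [pow_one, hy]⟩
    rw [hb] at hyb
    obtain ⟨z, rfl⟩ := IntermediateField.mem_bot.mp hyb
    refine ⟨z, (algebraMap L Ω).injective ?_⟩
    rw [frobenius_def, map_pow, hy]
  exact PerfectRing.toPerfectField L p

lemma value_of_max (O : ValuationSubring Ω) (φ : O →+* κ) (hφ : IsLocalHom φ)
    (hL : ResIn k O φ (Set.range (algebraMap L Ω)))
    (hmax : ∀ M : IntermediateField L Ω, ResIn k O φ (M : Set Ω) → M = ⊥) (x : Ω) (hx0 : x ≠ 0) :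
    ∃ a : L, a ≠ 0 ∧ O.valuation (algebraMap L Ω a) = O.valuation x := by
  classical
  set v := O.valuation with hv
  have hex : ∃ n : ℕ, 0 < n ∧ ∃ a : L, a ≠ 0 ∧ v (algebraMap L Ω a) = v x ^ n := by
    obtain ⟨p, hp0, hp⟩ := Algebra.IsAlgebraic.isAlgebraic (R := L) x
    by_contra hne
    push Not at hne
    have h1 := valuation_sum_ge v p.support (fun i => algebraMap L Ω (p.coeff i) * x ^ i) (by
      have key : ∀ i ∈ p.support, ∀ j ∈ p.support, i < j →
          v (algebraMap L Ω (p.coeff i) * x ^ i) ≠ v (algebraMap L Ω (p.coeff j) * x ^ j) := by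
        intro i hi j hj hij heq
        have hi' := Polynomial.mem_support_iff.mp hi
        have hj' := Polynomial.mem_support_iff.mp hj
        apply hne (j - i) (by omega) (p.coeff i / p.coeff j) (div_ne_zero hi' hj')
        exact value_quot v x hx0 _ _ hj' i j hij heq
      intro i hi j hj hij _
      rcases lt_or_gt_of_ne hij with h | h
      · exact key i hi j hj h
      · exact (key j hj i hi h).symm)
    have h2 : ∑ j ∈ p.support, algebraMap L Ω (p.coeff j) * x ^ j = 0 := by
      rw [← hp, Polynomial.aeval_def, Polynomial.eval₂_eq_sum, Polynomial.sum_def]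
    obtain ⟨i, hi⟩ := Polynomial.support_nonempty.mpr hp0
    have h3 := h1 i hi
    rw [h2, map_zero, le_zero_iff] at h3
    have hi' := Polynomial.mem_support_iff.mp hi
    simp [hi', hx0] at h3
  set n := Nat.find hex with hn
  obtain ⟨hn0, a, ha0, ha⟩ := Nat.find_spec hex
  have hmin : ∀ m, 0 < m → m < n → ∀ b : L, b ≠ 0 → v (algebraMap L Ω b) ≠ v x ^ m := by
    intro m hm0 hm b hb hbe
    exact Nat.find_min hex hm ⟨hm0, b, hb, hbe⟩
  obtain ⟨α, hα⟩ := IsAlgClosed.exists_pow_nat_eq (algebraMap L Ω a) hn0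
  have hvα : v α = v x := by
    rw [← hn] at ha hα
    rw [← hα, map_pow] at ha
    exact (pow_left_inj₀ zero_le' zero_le' hn0.ne').mp ha
  have hα0 : α ≠ 0 := by
    rintro rfl
    rw [map_zero, eq_comm] at hvα
    exact hx0 (by simpa using hvα)
  have hbot : IntermediateField.adjoin L {α} = ⊥ := by
    apply hmax
    intro y hy hyO
    have hαalg : IsAlgebraic L α := Algebra.IsAlgebraic.isAlgebraic α
    have hy' : y ∈ Algebra.adjoin L {α} := by
      rw [← IntermediateField.adjoin_simple_toSubalgebra_of_isAlgebraic hαalg]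
      exact hy
    rw [Algebra.adjoin_singleton_eq_range_aeval] at hy'
    obtain ⟨p, rfl⟩ := hy'
    have hmon : (Polynomial.X ^ n - Polynomial.C a : Polynomial L).Monic :=
      Polynomial.monic_X_pow_sub_C a hn0.ne'
    set q := p %ₘ (Polynomial.X ^ n - Polynomial.C a) with hq
    have hpq : Polynomial.aeval α p = Polynomial.aeval α q := by
      rw [hq, Polynomial.aeval_modByMonic_eq_self_of_root]
      rw [map_sub, map_pow, Polynomial.aeval_X, Polynomial.aeval_C, hα, sub_self]
    have hdeg : q.natDegree < n := by
      have h1 := Polynomial.natDegree_modByMonic_lt p hmon (by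
        intro h1
        have := congrArg Polynomial.natDegree h1
        rw [Polynomial.natDegree_X_pow_sub_C, Polynomial.natDegree_one] at this
        omega)
      rwa [Polynomial.natDegree_X_pow_sub_C] at h1
    have hsum : Polynomial.aeval α p =
        ∑ i ∈ Finset.range n, algebraMap L Ω (q.coeff i) * α ^ i := by
      rw [hpq, Polynomial.aeval_eq_sum_range' hdeg]
      simp only [Algebra.smul_def]
    have key : ∀ i ∈ Finset.range n, ∀ j ∈ Finset.range n, i < j →
        q.coeff i ≠ 0 → q.coeff j ≠ 0 →
        v (algebraMap L Ω (q.coeff i) * α ^ i) ≠ v (algebraMap L Ω (q.coeff j) * α ^ j) := by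
      intro i hi j hj hij hi' hj' heq
      have := value_quot v α hα0 _ _ hj' i j hij heq
      rw [hvα] at this
      rw [Finset.mem_range] at hi hj
      exact hmin (j - i) (by omega) (by omega) _ (div_ne_zero hi' hj') this
    have hge := valuation_sum_ge v (Finset.range n)
      (fun i => algebraMap L Ω (q.coeff i) * α ^ i) (by
        intro i hi j hj hij hne heq
        have hi' : q.coeff i ≠ 0 := by
          intro h; apply hne; rw [h, map_zero, zero_mul]
        have hj' : q.coeff j ≠ 0 := by
          intro h
          rw [h, map_zero, zero_mul, map_zero] at heq
          exact hne (by simpa using heq)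
        rcases lt_or_gt_of_ne hij with h | h
        · exact key i hi j hj h hi' hj' heq
        · exact key j hj i hi h hj' hi' heq.symm)
    rw [← hsum] at hge
    have hyv : v (Polynomial.aeval α p) ≤ 1 := (O.valuation_le_one_iff _).mpr hyO
    have hO : ∀ i ∈ Finset.range n, algebraMap L Ω (q.coeff i) * α ^ i ∈ O := fun i hi =>
      (O.valuation_le_one_iff _).mp ((hge i hi).trans hyv)
    have hφ0 : ∀ i (hi : i ∈ Finset.range n), i ≠ 0 → φ ⟨_, hO i hi⟩ = 0 := by
      intro i hi hi0
      by_contra hne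
      have hu : IsUnit (⟨_, hO i hi⟩ : O) := hφ.1 _ (isUnit_iff_ne_zero.mpr hne)
      have h1 : v (algebraMap L Ω (q.coeff i) * α ^ i) = 1 := (O.valuation_eq_one_iff _).mp hu
      have hi' : q.coeff i ≠ 0 := by
        intro h; rw [h, map_zero, zero_mul, map_zero] at h1; exact zero_ne_one h1
      have h2 := value_quot v α hα0 1 _ hi' 0 i (Nat.pos_of_ne_zero hi0) (by
        rw [h1, pow_zero, mul_one, map_one, map_one])
      rw [hvα] at h2
      rw [Finset.mem_range] at hi
      exact hmin (i - 0) (by omega) (by omega) _ (div_ne_zero one_ne_zero hi') h2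
    have h0n : 0 ∈ Finset.range n := Finset.mem_range.mpr hn0
    have hc0 : algebraMap L Ω (q.coeff 0) ∈ O := by
      have := hO 0 h0n
      rwa [pow_zero, mul_one] at this
    have hfin : (⟨Polynomial.aeval α p, hyO⟩ : O) =
        ∑ i ∈ (Finset.range n).attach, ⟨_, hO i i.2⟩ := by
      apply Subtype.ext
      rw [AddSubmonoidClass.coe_finset_sum]
      change Polynomial.aeval α p = _
      rw [hsum, ← Finset.sum_attach]
    obtain ⟨d, hd⟩ := hL _ ⟨_, rfl⟩ hc0
    refine ⟨d, ?_⟩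
    rw [hd]
    have : φ ⟨Polynomial.aeval α p, hyO⟩ = φ ⟨algebraMap L Ω (q.coeff 0), hc0⟩ := by
      rw [hfin, map_sum, Finset.sum_eq_single ⟨0, h0n⟩]
      · congr 1
        apply Subtype.ext
        simp
      · intro i _ hi
        exact hφ0 i i.2 (fun h => hi (Subtype.ext h))
      · intro h; exact absurd (Finset.mem_attach _ _) h
    exact this.symm
  have hαb : α ∈ (⊥ : IntermediateField L Ω) := by
    rw [← hbot]; exact IntermediateField.mem_adjoin_simple_self L α
  obtain ⟨b, rfl⟩ := IntermediateField.mem_bot.mp hαb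
  refine ⟨b, ?_, hvα⟩
  rintro rfl
  exact hα0 (map_zero _)
end


lemma loc_aux {Ω κ : Type*} [Field Ω] [Field κ] (O : ValuationSubring Ω) (φ : O →+* κ)
    (B : Subring Ω) (hBO : ∀ b ∈ B, b ∈ O) (hB : ∀ y : Ω, IsIntegral B y → y ∈ B)
    (x : Ω) (hx : x ∈ O) (n : ℕ) : ∀ g : Polynomial B, g.natDegree ≤ n →
    Polynomial.aeval x g = 0 → (∃ i, φ ⟨(g.coeff i : Ω), hBO _ (g.coeff i).2⟩ ≠ 0) →
    ∃ s, ∃ hs : s ∈ B, φ ⟨s, hBO s hs⟩ ≠ 0 ∧ s * x ∈ B := by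
  induction n with
  | zero =>
    rintro g hg hgx ⟨i, hi⟩
    exfalso
    rw [Polynomial.eq_C_of_natDegree_le_zero hg, Polynomial.aeval_C] at hgx
    have h0 : g.coeff 0 = 0 := Subtype.ext hgx
    have : g = 0 := by
      rw [Polynomial.eq_C_of_natDegree_le_zero hg, h0, map_zero]
    apply hi
    have h2 : (⟨(g.coeff i : Ω), hBO _ (g.coeff i).2⟩ : O) = 0 := by
      apply Subtype.ext
      simp [this]
    rw [h2, map_zero]
  | succ n ih =>
    rintro g hg hgx ⟨i, hi⟩
    have hIsInt : (g.coeff (n + 1) : Ω) * x ∈ B := by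
      by_cases hn : g.natDegree = n + 1
      · apply hB
        have := isIntegral_leadingCoeff_smul g x hgx
        rwa [Polynomial.leadingCoeff, hn] at this
      · rw [Polynomial.coeff_eq_zero_of_natDegree_lt (by omega)]
        simp
    by_cases hlead : φ ⟨(g.coeff (n + 1) : Ω), hBO _ (g.coeff (n + 1)).2⟩ = 0
    · set b : B := ⟨_, hIsInt⟩ with hb
      have hbφ : φ ⟨(b : Ω), hBO _ b.2⟩ = 0 := by
        have : (⟨(b : Ω), hBO _ b.2⟩ : O) =
          ⟨(g.coeff (n + 1) : Ω), hBO _ (g.coeff (n + 1)).2⟩ * ⟨x, hx⟩ := rfl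
        rw [this, map_mul, hlead, zero_mul]
      let g' : Polynomial B := g - Polynomial.monomial (n + 1) (g.coeff (n + 1)) +
        Polynomial.monomial n b
      have hco : ∀ j, g'.coeff j = if j = n + 1 then 0 else if j = n then g.coeff j + b
          else g.coeff j := by
        intro j
        simp only [g', Polynomial.coeff_add, Polynomial.coeff_sub, Polynomial.coeff_monomial]
        split_ifs <;> first | omega | (subst_vars; simp)
      refine ih g' ?_ ?_ ?_
      · rw [Polynomial.natDegree_le_iff_coeff_eq_zero]
        intro N hN
        rw [hco]
        split_ifs with h1 h2
        · rfl
        · omega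
        · exact Polynomial.coeff_eq_zero_of_natDegree_lt (by omega)
      · simp only [g', map_add, map_sub, hgx, Polynomial.aeval_monomial]
        change 0 - (g.coeff (n + 1) : Ω) * x ^ (n + 1) + (g.coeff (n + 1) : Ω) * x * x ^ n = 0
        ring
      · by_cases h1 : i = n + 1
        · subst h1; exact absurd hlead hi
        · refine ⟨i, ?_⟩
          by_cases h2 : i = n
          · have h3 : (⟨(g'.coeff i : Ω), hBO _ (g'.coeff i).2⟩ : O) =
              ⟨(g.coeff i : Ω), hBO _ (g.coeff i).2⟩ + ⟨(b : Ω), hBO _ b.2⟩ := by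
              apply Subtype.ext
              change (g'.coeff i : Ω) = (g.coeff i : Ω) + b
              rw [hco, if_neg h1, if_pos h2]; rfl
            rw [h3, map_add, hbφ, add_zero]
            exact hi
          · have h3 : (⟨(g'.coeff i : Ω), hBO _ (g'.coeff i).2⟩ : O) =
              ⟨(g.coeff i : Ω), hBO _ (g.coeff i).2⟩ := by
              apply Subtype.ext
              change (g'.coeff i : Ω) = (g.coeff i : Ω)
              rw [hco, if_neg h1, if_neg h2]
            rw [h3]
            exact hi
    · exact ⟨_, (g.coeff (n + 1)).2, hlead, hIsInt⟩

open scoped Pointwise in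
lemma conj_place_aux {A L Ω κ : Type*} [CommRing A] [Field L] [Field Ω] [Field κ] [Algebra L Ω]
    [IsGalois L Ω] [Algebra A L] [Algebra A Ω] [IsScalarTower A L Ω]
    (O : ValuationSubring Ω) (φ : O →+* κ) (hφ : IsLocalHom φ)
    (hAO : ∀ a : A, algebraMap A Ω a ∈ O)
    (hAL : ∀ x : L, algebraMap L Ω x ∈ O → ∃ a : A, algebraMap A L a = x)
    (hsurj : ∀ c : κ, ∃ (b : Ω) (hb : b ∈ O), IsIntegral A b ∧ φ ⟨b, hb⟩ = c)
    (τ : κ ≃+* κ)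
    (hτ : ∀ (x : L) (hx : algebraMap L Ω x ∈ O), τ (φ ⟨_, hx⟩) = φ ⟨_, hx⟩) :
    ∃ σ : Ω ≃ₐ[L] Ω, ∀ x : Ω, ∀ hx : x ∈ O, ∃ hx' : σ x ∈ O, φ ⟨σ x, hx'⟩ = τ (φ ⟨x, hx⟩) := by
  classical
  let AO : A →+* O := (algebraMap A Ω).codRestrict O.toSubring hAO
  have hIntMem : ∀ y : Ω, IsIntegral A y → y ∈ O := by
    intro y hy
    have h1 : IsIntegral O y := hy.map_of_comp_eq AO (RingHom.id Ω) rfl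
    obtain ⟨z, rfl⟩ := IsIntegrallyClosed.isIntegral_iff.mp h1
    exact z.2
  let B := integralClosure A Ω
  have hB : ∀ b : B, (b : Ω) ∈ O := fun b => hIntMem b b.2
  have hBσ : ∀ (σ : Ω ≃ₐ[L] Ω) (b : B), σ b ∈ B := fun σ b =>
    IsIntegral.map (σ.restrictScalars A : Ω ≃ₐ[A] Ω) b.2
  let _ : MulSemiringAction (Ω ≃ₐ[L] Ω) B :=
    { smul := fun σ b => ⟨σ b, hBσ σ b⟩
      one_smul := fun b => rfl
      mul_smul := fun σ τ b => rfl
      smul_zero := fun σ => Subtype.ext (map_zero σ)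
      smul_add := fun σ x y => Subtype.ext (map_add σ _ _)
      smul_one := fun σ => Subtype.ext (map_one σ)
      smul_mul := fun σ x y => Subtype.ext (map_mul σ _ _) }
  have hsm : ∀ (σ : Ω ≃ₐ[L] Ω) (b : B), ((σ • b : B) : Ω) = σ b := fun σ b => rfl
  have : SMulCommClass (Ω ≃ₐ[L] Ω) A B := ⟨fun σ a b => Subtype.ext (by
    rw [hsm]
    change σ (a • (b : Ω)) = a • σ b
    exact map_smul (σ.restrictScalars A) a (b : Ω))⟩
  let _ : TopologicalSpace B := ⊥
  have : DiscreteTopology B := ⟨rfl⟩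
  have : ContinuousSMul (Ω ≃ₐ[L] Ω) B := by
    rw [continuousSMul_iff_stabilizer_isOpen]
    intro b
    convert stabilizer_isOpen_of_isIntegral (K := L) (L := Ω) (b : Ω) using 1
    ext σ
    simp only [SetLike.mem_coe, MulAction.mem_stabilizer_iff]
    rw [← Subtype.coe_inj]
    rfl
  have : Algebra.IsInvariant A B (Ω ≃ₐ[L] Ω) := by
    constructor
    intro b hb
    have h1 : (b : Ω) ∈ (⊥ : IntermediateField L Ω) := by
      rw [InfiniteGalois.mem_bot_iff_fixed]
      intro σ
      exact congrArg Subtype.val (hb σ)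
    obtain ⟨x, hx⟩ := IntermediateField.mem_bot.mp h1
    obtain ⟨a, ha⟩ := hAL x (by rw [hx]; exact hB b)
    refine ⟨a, Subtype.ext ?_⟩
    change algebraMap A Ω a = b
    rw [IsScalarTower.algebraMap_apply A L Ω, ha, hx]
  let φB : B →+* κ := φ.comp (B.val.toRingHom.codRestrict O.toSubring hB)
  have hφB : ∀ b : B, φB b = φ ⟨b, hB b⟩ := fun b => rfl
  have hφBs : Function.Surjective φB := by
    intro c
    obtain ⟨b, hb, hbi, hbc⟩ := hsurj c
    exact ⟨⟨b, hbi⟩, hbc⟩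
  let P : Ideal B := RingHom.ker φB
  have hPp : P.IsPrime := RingHom.ker_isPrime φB
  let p : Ideal A := P.under A
  have : P.LiesOver p := ⟨rfl⟩
  let e : B ⧸ P ≃+* κ := RingHom.quotientKerEquivOfSurjective hφBs
  have he : ∀ b : B, e (Ideal.Quotient.mk P b) = φB b := fun b => rfl
  let τ' : (B ⧸ P) ≃ₐ[A ⧸ p] (B ⧸ P) := AlgEquiv.ofRingEquiv (f := (e.trans τ).trans e.symm) (by
    intro a
    obtain ⟨a, rfl⟩ := Ideal.Quotient.mk_surjective a
    rw [Ideal.Quotient.algebraMap_mk_of_liesOver]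
    rw [RingEquiv.trans_apply, RingEquiv.trans_apply, RingEquiv.symm_apply_eq, he, hφB]
    have h1 : (⟨((algebraMap A B a : B) : Ω), hB _⟩ : O) =
        ⟨algebraMap L Ω (algebraMap A L a), by
          rw [← IsScalarTower.algebraMap_apply]; exact hAO a⟩ := by
      apply Subtype.ext
      exact IsScalarTower.algebraMap_apply A L Ω a
    rw [h1]
    exact hτ _ _)
  have hτ' : ∀ b : B, e (τ' (Ideal.Quotient.mk P b)) = τ (φB b) := fun b => e.apply_symm_apply _
  obtain ⟨σ, hσ⟩ := Ideal.Quotient.stabilizerHom_surjective_of_profinite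
    (G := (Ω ≃ₐ[L] Ω)) p P τ'
  have hσB : ∀ b : B, φB ((σ : Ω ≃ₐ[L] Ω) • b) = τ (φB b) := by
    intro b
    rw [← hτ', ← hσ, Ideal.Quotient.stabilizerHom_apply, he]
    rfl
  refine ⟨σ, fun x hx => ?_⟩
  -- write x = b / s
  obtain ⟨s, hs, hsφ, hsx⟩ : ∃ s, ∃ hs : s ∈ B, φ ⟨s, hIntMem s hs⟩ ≠ 0 ∧ s * x ∈ B := by
    obtain ⟨g, hg0, hgx⟩ := Algebra.IsAlgebraic.isAlgebraic (R := L) x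
    obtain ⟨q, ⟨n, hn⟩, c, hc, hq⟩ := prim_poly (O.comap (algebraMap L Ω)) g hg0
    let θ : (O.comap (algebraMap L Ω)) →+* B.toSubring :=
      ((algebraMap L Ω).comp (algebraMap (O.comap (algebraMap L Ω)) L)).codRestrict B.toSubring
      (fun y => by
        obtain ⟨a, ha⟩ := hAL (y : L) y.2
        change algebraMap L Ω (y : L) ∈ B
        rw [← ha, ← IsScalarTower.algebraMap_apply]
        exact B.algebraMap_mem a)
    refine loc_aux O φ B.toSubring (fun b hb => hIntMem b hb) ?_ x hx q.natDegree (q.map θ)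
      Polynomial.natDegree_map_le ?_ ⟨n, ?_⟩
    · intro y hy
      exact isIntegral_trans (R := A) (A := B) y hy
    · rw [Polynomial.aeval_def, Polynomial.eval₂_map]
      change q.eval₂ ((algebraMap L Ω).comp (algebraMap (O.comap (algebraMap L Ω)) L)) x = 0
      rw [← Polynomial.eval₂_map, hq, Polynomial.eval₂_mul]
      change _ * Polynomial.aeval x g = 0
      rw [hgx, mul_zero]
    · let θ' : (O.comap (algebraMap L Ω)) →+* O :=
        ((algebraMap L Ω).comp (algebraMap (O.comap (algebraMap L Ω)) L)).codRestrict O.toSubring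
          (fun y => y.2)
      have h1 : IsUnit (φ (θ' (q.coeff n))) := (hn.map θ').map φ
      have h2 : (⟨((q.map θ).coeff n : Ω), hIntMem _ ((q.map θ).coeff n).2⟩ : O) =
          θ' (q.coeff n) := by
        apply Subtype.ext
        change ((q.map θ).coeff n : Ω) = _
        rw [Polynomial.coeff_map]
        rfl
      rw [h2]
      exact h1.ne_zero
  have hs1 := hσB ⟨s, hs⟩
  have hs2 := hσB ⟨s * x, hsx⟩
  set σ' : Ω ≃ₐ[L] Ω := (σ : Ω ≃ₐ[L] Ω) with hσ'
  rw [hφB, hφB] at hs1 hs2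
  have hσs : σ' s ∈ O := hB (σ' • ⟨s, hs⟩)
  have hσsx : σ' (s * x) ∈ O := hB (σ' • ⟨s * x, hsx⟩)
  have e1 : φ ⟨σ' s, hσs⟩ = τ (φ ⟨s, hIntMem s hs⟩) := hs1
  have e2 : φ ⟨σ' (s * x), hσsx⟩ = τ (φ ⟨s * x, hIntMem _ hsx⟩) := hs2
  have hτs : τ (φ ⟨s, hIntMem s hs⟩) ≠ 0 := by
    simpa using hsφ
  have hu : IsUnit (⟨σ' s, hσs⟩ : O) := hφ.1 _ (by
    rw [e1]; exact isUnit_iff_ne_zero.mpr hτs)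
  obtain ⟨w, hw⟩ := isUnit_iff_exists_inv.mp hu
  have hw' : σ' s * (w : Ω) = 1 := congrArg Subtype.val hw
  have hσx : σ' x = w * σ' (s * x) := by
    rw [map_mul, ← mul_assoc, mul_comm (w : Ω), hw', one_mul]
  have hσxO : σ' x ∈ O := by rw [hσx]; exact mul_mem w.2 hσsx
  refine ⟨hσxO, ?_⟩
  have e3 : (⟨σ' (s * x), hσsx⟩ : O) = ⟨σ' s, hσs⟩ * ⟨σ' x, hσxO⟩ :=
    Subtype.ext (map_mul σ' s x)
  have e4 : (⟨s * x, hIntMem _ hsx⟩ : O) = ⟨s, hIntMem s hs⟩ * ⟨x, hx⟩ := rfl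
  rw [e3, e4, map_mul, map_mul, map_mul, e1] at e2
  exact mul_left_cancel₀ hτs e2

lemma lift_int {L Ω κ : Type*} [Field L] [Field Ω] [Field κ] [Algebra L Ω]
    [IsAlgClosed Ω] (O : ValuationSubring Ω) (φ : O →+* κ)
    (hlift : ∀ c : κ, ∃ q : Polynomial O, q.Monic ∧
      (∀ i, (q.coeff i : Ω) ∈ Set.range (algebraMap L Ω)) ∧ q.eval₂ φ c = 0) (c : κ) :
    ∃ (b : Ω) (hb : b ∈ O), IsIntegral (O.comap (algebraMap L Ω)).toSubring b ∧ φ ⟨b, hb⟩ = c := by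
  classical
  let A : Subring L := (O.comap (algebraMap L Ω)).toSubring
  obtain ⟨q, hq, hqL, hqc⟩ := hlift c
  -- split q over Ω; the roots are integral
  have hsp : (q.map (algebraMap O Ω)).Splits := IsAlgClosed.splits _
  have hqm : (q.map (algebraMap O Ω)).Monic := hq.map _
  let AO : A →+* O := (algebraMap A Ω).codRestrict O.toSubring (fun a => a.2)
  have hql : q ∈ Polynomial.lifts AO := by
    rw [Polynomial.lifts_iff_coeff_lifts]
    intro i
    obtain ⟨y, hy⟩ := hqL i
    exact ⟨⟨y, by change algebraMap L Ω y ∈ O; rw [hy]; exact (q.coeff i).2⟩, Subtype.ext hy⟩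
  obtain ⟨q', hq', -, hq'm⟩ := Polynomial.lifts_and_degree_eq_and_monic hql hq
  have hIsInt : ∀ r ∈ (q.map (algebraMap O Ω)).roots, IsIntegral A r := by
    intro r hr
    refine ⟨q', hq'm, ?_⟩
    have h1 := (Polynomial.mem_roots'.mp hr).2
    rw [Polynomial.IsRoot, Polynomial.eval_map, ← hq', Polynomial.eval₂_map] at h1
    exact h1
  have hIntMem : ∀ y : Ω, IsIntegral A y → y ∈ O := by
    intro y hy
    have h1 : IsIntegral O y := hy.map_of_comp_eq AO (RingHom.id Ω) rfl
    obtain ⟨z, rfl⟩ := IsIntegrallyClosed.isIntegral_iff.mp h1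
    exact z.2
  have hprod := hsp.eq_prod_roots_of_monic hqm
  let R : Multiset O := (q.map (algebraMap O Ω)).roots.pmap (fun r hr => ⟨r, hr⟩)
    (fun r hr => hIntMem r (hIsInt r hr))
  have hqR : q = (R.map fun r => Polynomial.X - Polynomial.C r).prod := by
    apply Polynomial.map_injective (algebraMap O Ω) Subtype.val_injective
    conv_lhs => rw [hprod]
    rw [Polynomial.map_multiset_prod, Multiset.map_map, Multiset.map_pmap]
    simp only [Function.comp_def, Polynomial.map_sub, Polynomial.map_X, Polynomial.map_C]
    change _ = (Multiset.pmap (fun a h => (Polynomial.X - Polynomial.C a : Polynomial Ω)) _ _).prod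
    rw [Multiset.pmap_eq_map]
  have h0 : (R.map fun r => c - φ r).prod = 0 := by
    rw [← hqc]
    conv_rhs => rw [hqR]
    rw [← Polynomial.coe_eval₂RingHom, map_multiset_prod, Multiset.map_map]
    simp
  rw [Multiset.prod_eq_zero_iff] at h0
  obtain ⟨r, hr, hrc⟩ := Multiset.mem_map.mp h0
  obtain ⟨r', hr', rfl⟩ := Multiset.mem_pmap.mp hr
  exact ⟨r', hIntMem _ (hIsInt r' hr'), hIsInt r' hr', (sub_eq_zero.mp hrc).symm⟩

lemma conj_place {L Ω κ : Type*} [Field L] [Field Ω] [Field κ] [Algebra L Ω]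
    [IsGalois L Ω] [IsAlgClosed Ω]
    (O : ValuationSubring Ω) (φ : O →+* κ) (hφ : IsLocalHom φ)
    (hlift : ∀ c : κ, ∃ q : Polynomial O, q.Monic ∧
      (∀ i, (q.coeff i : Ω) ∈ Set.range (algebraMap L Ω)) ∧ q.eval₂ φ c = 0)
    (τ : κ ≃+* κ)
    (hτ : ∀ (x : L) (hx : algebraMap L Ω x ∈ O), τ (φ ⟨_, hx⟩) = φ ⟨_, hx⟩) :
    ∃ σ : Ω ≃ₐ[L] Ω, ∀ x : Ω, ∀ hx : x ∈ O, ∃ hx' : σ x ∈ O, φ ⟨σ x, hx'⟩ = τ (φ ⟨x, hx⟩) := by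
  let A : Subring L := (O.comap (algebraMap L Ω)).toSubring
  exact conj_place_aux (A := A) O φ hφ (fun a => a.2) (fun x hx => ⟨⟨x, hx⟩, rfl⟩)
    (lift_int O φ hlift) τ hτ


lemma contin_crit {G k κ : Type*} [Group G] [TopologicalSpace G] [IsTopologicalGroup G]
    [Field k] [Field κ] [Algebra k κ] (f : G →* (κ ≃ₐ[k] κ))
    (h : ∀ c : κ, {g : G | f g c = c} ∈ nhds (1 : G)) : Continuous f := by
  apply continuous_of_continuousAt_one f
  intro s hs
  rw [map_one, krullTopology_mem_nhds_one_iff] at hs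
  obtain ⟨E, hE, hEs⟩ := hs
  have hfg : E.FG := IntermediateField.essFiniteType_iff.mp inferInstance
  obtain ⟨t, ht⟩ := hfg
  have h1 : (⋂ c ∈ t, {g : G | f g c = c}) ∈ nhds (1 : G) :=
    (Filter.biInter_finset_mem t).mpr fun c _ => h c
  refine Filter.mem_map.mpr (Filter.mem_of_superset h1 ?_)
  intro g hg
  apply hEs
  simp only [Set.mem_iInter, Set.mem_setOf_eq] at hg
  have hle : E ≤ IntermediateField.fixedField (Subgroup.zpowers (f g)) := by
    rw [← ht, IntermediateField.adjoin_le_iff]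
    intro c hc
    rw [SetLike.mem_coe, IntermediateField.mem_fixedField_iff]
    intro γ hγ
    have : Subgroup.zpowers (f g) ≤ MulAction.stabilizer (κ ≃ₐ[k] κ) c := by
      rw [Subgroup.zpowers_le]
      exact hg c hc
    exact this hγ
  rw [SetLike.mem_coe, IntermediateField.mem_fixingSubgroup_iff]
  intro c hc
  exact (IntermediateField.mem_fixedField_iff _ _).mp (hle hc) _ (Subgroup.mem_zpowers _)

lemma isOpen_eval {L Ω : Type*} [Field L] [Field Ω] [Algebra L Ω] [Algebra.IsAlgebraic L Ω]
    (x : Ω) (S : Set Ω) : IsOpen {σ : Ω ≃ₐ[L] Ω | σ x ∈ S} := by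
  have hst : IsOpen (MulAction.stabilizer (Ω ≃ₐ[L] Ω) x : Set (Ω ≃ₐ[L] Ω)) :=
    stabilizer_isOpen_of_isIntegral x
  rw [isOpen_iff_mem_nhds]
  intro σ hσ
  have h1 : IsOpen ((fun σ' => σ⁻¹ * σ') ⁻¹'
      (MulAction.stabilizer (Ω ≃ₐ[L] Ω) x : Set (Ω ≃ₐ[L] Ω))) :=
    hst.preimage (continuous_const.mul continuous_id)
  refine Filter.mem_of_superset (h1.mem_nhds (by simp)) ?_
  intro σ' h'
  have h2 : (σ⁻¹ * σ') x = x := h'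
  have h3 : σ' x = σ x := by
    have := congrArg σ h2
    rw [← AlgEquiv.mul_apply, mul_inv_cancel_left] at this
    exact this
  simp only [Set.mem_setOf_eq] at hσ ⊢
  rwa [h3]

lemma isClosed_eval {L Ω : Type*} [Field L] [Field Ω] [Algebra L Ω] [Algebra.IsAlgebraic L Ω]
    (x : Ω) (S : Set Ω) : IsClosed {σ : Ω ≃ₐ[L] Ω | σ x ∈ S} := by
  rw [← isOpen_compl_iff]
  exact isOpen_eval (L := L) x Sᶜ

def Compat {L Ω k κ : Type*} [Field L] [Field Ω] [Field k] [Field κ] [Algebra L Ω]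
    [Algebra k κ] (O : ValuationSubring Ω) (φ : O →+* κ) (σ : Ω ≃ₐ[L] Ω) (τ : κ ≃ₐ[k] κ) : Prop :=
  ∀ (x : Ω) (hx : x ∈ O), ∃ hx' : σ x ∈ O, φ ⟨σ x, hx'⟩ = τ (φ ⟨x, hx⟩)

section
variable {L Ω k κ : Type*} [Field L] [Field Ω] [Field k] [Field κ] [Algebra L Ω]
    [Algebra k κ] [IsGalois L Ω] [IsGalois k κ]

lemma closed_eq_top (O : ValuationSubring Ω) (φ : O →+* κ)
    (hmax : ∀ M : IntermediateField L Ω, ResIn k O φ (M : Set Ω) → M = ⊥)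
    (H : Subgroup (Ω ≃ₐ[L] Ω)) (hH : IsClosed (H : Set (Ω ≃ₐ[L] Ω)))
    (hc : ∀ τ : κ ≃ₐ[k] κ, ∃ σ ∈ H, Compat O φ σ τ) : H = ⊤ := by
  have h1 : IntermediateField.fixedField H = ⊥ := by
    apply hmax
    intro x hx hxO
    have h2 : φ ⟨x, hxO⟩ ∈ (⊥ : IntermediateField k κ) := by
      rw [InfiniteGalois.mem_bot_iff_fixed]
      intro τ
      obtain ⟨σ, hσ, hcomp⟩ := hc τ
      obtain ⟨hx', h⟩ := hcomp x hxO
      rw [← h]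
      congr 1
      apply Subtype.ext
      exact (IntermediateField.mem_fixedField_iff _ _).mp hx σ hσ
    rw [IntermediateField.mem_bot] at h2
    exact h2
  have h2 := InfiniteGalois.fixingSubgroup_fixedField ⟨H, hH⟩
  change (IntermediateField.fixedField H).fixingSubgroup = H at h2
  rw [← h2, h1, IntermediateField.fixingSubgroup_bot]

lemma all_preserve (O : ValuationSubring Ω) (φ : O →+* κ) (hφ : IsLocalHom φ)
    (hmax : ∀ M : IntermediateField L Ω, ResIn k O φ (M : Set Ω) → M = ⊥)
    (hc : ∀ τ : κ ≃ₐ[k] κ, ∃ σ : Ω ≃ₐ[L] Ω, Compat O φ σ τ) (σ : Ω ≃ₐ[L] Ω)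
    (x : Ω) (hx : x ∈ O) : ∃ hx' : σ x ∈ O,
      (φ ⟨x, hx⟩ ∈ (algebraMap k κ).range → φ ⟨σ x, hx'⟩ = φ ⟨x, hx⟩) := by
  let S : ∀ x ∈ O, Set Ω := fun x hx => {y | ∃ hy : y ∈ O,
    (φ ⟨x, hx⟩ ∈ (algebraMap k κ).range → φ ⟨y, hy⟩ = φ ⟨x, hx⟩)}
  let D : Subgroup (Ω ≃ₐ[L] Ω) :=
    { carrier := {σ | ∀ x hx, σ x ∈ S x hx ∧ σ⁻¹ x ∈ S x hx}
      mul_mem' := by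
        intro a b ha hb x hx
        have key : ∀ a b : Ω ≃ₐ[L] Ω, (∀ x hx, a x ∈ S x hx) → (∀ x hx, b x ∈ S x hx) →
            (a * b) x ∈ S x hx := by
          intro a b ha hb
          obtain ⟨h1, h2⟩ := hb x hx
          obtain ⟨h3, h4⟩ := ha _ h1
          refine ⟨h3, fun h => ?_⟩
          have h5 := h2 h
          rw [← h5]
          exact h4 (by rw [h5]; exact h)
        refine ⟨key a b (fun x hx => (ha x hx).1) (fun x hx => (hb x hx).1), ?_⟩
        rw [mul_inv_rev]
        exact key _ _ (fun x hx => (hb x hx).2) (fun x hx => (ha x hx).2)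
      one_mem' := fun x hx => ⟨⟨hx, fun _ => rfl⟩, ⟨by simpa using hx, fun _ => by simp⟩⟩
      inv_mem' := by
        intro a ha x hx
        refine ⟨(ha x hx).2, ?_⟩
        rw [inv_inv]
        exact (ha x hx).1 }
  have hD : IsClosed (D : Set (Ω ≃ₐ[L] Ω)) := by
    have : (D : Set (Ω ≃ₐ[L] Ω)) = ⋂ x, ⋂ hx, ({σ | σ x ∈ S x hx} ∩ {σ | σ⁻¹ x ∈ S x hx}) := by
      ext σ
      simp only [Set.mem_iInter]
      rfl
    rw [this]
    refine isClosed_iInter fun x => isClosed_iInter fun hx => (isClosed_eval x _).inter ?_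
    exact (isClosed_eval (L := L) x (S x hx)).preimage continuous_inv
  have hT : D = ⊤ := by
    apply closed_eq_top O φ hmax D hD
    intro τ
    obtain ⟨σ, hσ⟩ := hc τ
    refine ⟨σ, ?_, hσ⟩
    have hinv : ∀ x ∈ O, σ⁻¹ x ∈ O := by
      intro x hx
      by_contra hn
      have h1 : (σ⁻¹ x)⁻¹ ∈ O := (O.mem_or_inv_mem _).resolve_left hn
      have h0 : φ ⟨_, h1⟩ = 0 := by
        by_contra h0
        have hu : IsUnit (⟨_, h1⟩ : O) := hφ.map_nonunit _ (isUnit_iff_ne_zero.mpr h0)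
        obtain ⟨w, hw⟩ := hu.exists_right_inv
        have hw' : (σ⁻¹ x)⁻¹ * (w : Ω) = 1 := congrArg Subtype.val hw
        have : (w : Ω) = σ⁻¹ x := by
          rw [eq_inv_of_mul_eq_one_right hw', inv_inv]
        exact hn (this ▸ w.2)
      obtain ⟨h2, h3⟩ := hσ _ h1
      rw [h0, map_zero] at h3
      have h4 : σ ((σ⁻¹ x)⁻¹) = x⁻¹ := by
        rw [map_inv₀, ← AlgEquiv.mul_apply, mul_inv_cancel, AlgEquiv.one_apply]
      have hx0 : x ≠ 0 := by
        rintro rfl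
        exact hn (by simp)
      have h5 : φ (⟨_, h2⟩ * ⟨x, hx⟩) = 1 := by
        rw [← map_one φ]
        congr 1
        apply Subtype.ext
        change σ ((σ⁻¹ x)⁻¹) * x = 1
        rw [h4, inv_mul_cancel₀ hx0]
      rw [map_mul, h3, zero_mul] at h5
      exact zero_ne_one h5
    intro x hx
    constructor
    · obtain ⟨h1, h2⟩ := hσ x hx
      refine ⟨h1, ?_⟩
      rintro ⟨c, hc'⟩
      rw [h2, ← hc', AlgEquiv.commutes]
    · refine ⟨hinv x hx, ?_⟩
      rintro ⟨c, hc'⟩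
      obtain ⟨h1, h2⟩ := hσ _ (hinv x hx)
      have h3 : (⟨σ (σ⁻¹ x), h1⟩ : O) = ⟨x, hx⟩ := by
        apply Subtype.ext
        change σ (σ⁻¹ x) = x
        rw [← AlgEquiv.mul_apply, mul_inv_cancel, AlgEquiv.one_apply]
      rw [h3, ← hc', ← AlgEquiv.commutes τ c] at h2
      rw [← hc']
      exact (τ.injective h2).symm
  have : σ ∈ D := hT ▸ Subgroup.mem_top σ
  exact (this x hx).1

lemma exists_rho (O : ValuationSubring Ω) (φ : O →+* κ) (hφ : IsLocalHom φ)
    (hsurj : Function.Surjective φ)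
    (hmax : ∀ M : IntermediateField L Ω, ResIn k O φ (M : Set Ω) → M = ⊥)
    (hc : ∀ τ : κ ≃ₐ[k] κ, ∃ σ : Ω ≃ₐ[L] Ω, Compat O φ σ τ) :
    ∃ ρ : (Ω ≃ₐ[L] Ω) →* (κ ≃ₐ[k] κ), Continuous ρ ∧ Function.Surjective ρ ∧
      ∀ σ, Compat O φ σ (ρ σ) := by
  have hp := all_preserve O φ hφ hmax hc
  choose hp1 hp2 using hp
  have uniq : ∀ (σ : Ω ≃ₐ[L] Ω) (τ τ' : κ ≃ₐ[k] κ), Compat O φ σ τ → Compat O φ σ τ' → τ = τ' := by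
    intro σ τ τ' h h'
    ext c
    obtain ⟨⟨x, hx⟩, rfl⟩ := hsurj c
    obtain ⟨h1, h2⟩ := h x hx
    obtain ⟨h3, h4⟩ := h' x hx
    rw [← h2, ← h4]
  have hker : ∀ σ : Ω ≃ₐ[L] Ω, ∀ x y : O, φ x = φ y →
      φ ⟨σ x, hp1 σ x x.2⟩ = φ ⟨σ y, hp1 σ y y.2⟩ := by
    intro σ x y hxy
    have h0 : φ (x - y) = 0 := by rw [map_sub, hxy, sub_self]
    have h1 := hp2 σ (x - y : O) (x - y : O).2 ⟨0, by rw [map_zero]; exact h0.symm⟩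
    have h2 : (⟨σ (x - y : O), hp1 σ (x - y : O) (x - y : O).2⟩ : O) =
      ⟨σ x, hp1 σ x x.2⟩ - ⟨σ y, hp1 σ y y.2⟩ := by
      apply Subtype.ext
      change σ (x - y : Ω) = σ x - σ y
      rw [map_sub]
    rw [h2, map_sub] at h1
    exact sub_eq_zero.mp (h1.trans h0)
  have hex : ∀ σ : Ω ≃ₐ[L] Ω, ∃ τ : κ ≃ₐ[k] κ, Compat O φ σ τ := by
    intro σ
    choose s hs using hsurj
    let g : (Ω ≃ₐ[L] Ω) → κ → κ := fun σ c => φ ⟨σ (s c), hp1 σ _ (s c).2⟩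
    have hg : ∀ σ (x : O), g σ (φ x) = φ ⟨σ x, hp1 σ x x.2⟩ := fun σ x => hker σ _ _ (hs _)
    have hgg : ∀ σ σ' : Ω ≃ₐ[L] Ω, σ * σ' = 1 → ∀ c, g σ (g σ' c) = c := by
      intro σ σ' h c
      obtain ⟨x, rfl⟩ : ∃ x, φ x = c := ⟨s c, hs c⟩
      rw [hg σ', hg σ]
      congr 1
      apply Subtype.ext
      change (σ * σ') x = x
      rw [h, AlgEquiv.one_apply]
    let τ : κ ≃ₐ[k] κ :=
      { toFun := g σ
        invFun := g σ⁻¹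
        left_inv := hgg _ _ (inv_mul_cancel _)
        right_inv := hgg _ _ (mul_inv_cancel _)
        map_mul' := by
          intro c d
          obtain ⟨x, rfl⟩ : ∃ x, φ x = c := ⟨s c, hs c⟩
          obtain ⟨y, rfl⟩ : ∃ y, φ y = d := ⟨s d, hs d⟩
          rw [← map_mul, hg, hg, hg, ← map_mul]
          congr 1
          exact Subtype.ext (map_mul σ _ _)
        map_add' := by
          intro c d
          obtain ⟨x, rfl⟩ : ∃ x, φ x = c := ⟨s c, hs c⟩
          obtain ⟨y, rfl⟩ : ∃ y, φ y = d := ⟨s d, hs d⟩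
          rw [← map_add, hg, hg, hg, ← map_add]
          congr 1
          exact Subtype.ext (map_add σ _ _)
        commutes' := by
          intro r
          have h1 := hp2 σ _ (s (algebraMap k κ r)).2 ⟨r, (hs _).symm⟩
          exact h1.trans (hs _) }
    exact ⟨τ, fun x hx => ⟨hp1 σ x hx, (hg σ ⟨x, hx⟩).symm⟩⟩
  choose r hr using hex
  let ρ : (Ω ≃ₐ[L] Ω) →* (κ ≃ₐ[k] κ) := MonoidHom.mk' r (by
    intro a b
    apply uniq (a * b) _ _ (hr _)
    intro x hx
    obtain ⟨h1, h2⟩ := hr b x hx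
    obtain ⟨h3, h4⟩ := hr a _ h1
    exact ⟨h3, h4.trans (by rw [h2]; rfl)⟩)
  refine ⟨ρ, ?_, ?_, hr⟩
  · apply contin_crit
    intro c
    obtain ⟨⟨x, hx⟩, rfl⟩ := hsurj c
    have h1 : {σ : Ω ≃ₐ[L] Ω | σ x ∈ ({x} : Set Ω)} ∈ nhds (1 : Ω ≃ₐ[L] Ω) :=
      (isOpen_eval x {x}).mem_nhds (by simp)
    refine Filter.mem_of_superset h1 ?_
    intro σ hσ
    obtain ⟨h2, h3⟩ := hr σ x hx
    change r σ _ = _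
    rw [← h3]
    congr 1
    exact Subtype.ext hσ
  · intro τ
    obtain ⟨σ, hσ⟩ := hc τ
    exact ⟨σ, uniq _ _ _ (hr σ) hσ⟩

end


lemma tame_fix {L Ω k κ : Type*} [Field L] [Field Ω] [Field k] [Field κ] [Algebra L Ω]
    [Algebra k κ] (O : ValuationSubring Ω) (φ : O →+* κ)
    (hval : ∀ x : Ω, x ≠ 0 → ∃ a : L, a ≠ 0 ∧ O.valuation (algebraMap L Ω a) = O.valuation x)
    (τ : Ω ≃ₐ[L] Ω) (hτ : Compat O φ τ (1 : κ ≃ₐ[k] κ)) (n : ℕ) (hn : (n : κ) ≠ 0)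
    (y : Ω) (hy : (τ ^ n) y = y) : τ y = y := by
  have hnΩ : (n : Ω) ≠ 0 := by
    intro h
    apply hn
    have h1 : (n : O) = 0 := Subtype.ext (by simpa using h)
    rw [← map_natCast φ, h1, map_zero]
  set t := ∑ i ∈ Finset.range n, (τ ^ i) y with ht
  have htt : τ t = t := by
    have h1 := Finset.sum_range_succ (fun i => (τ ^ i) y) n
    rw [Finset.sum_range_succ'] at h1
    simp only [pow_zero, AlgEquiv.one_apply, hy] at h1
    rw [ht, map_sum]
    have h2 := add_right_cancel h1
    rw [← h2]
    apply Finset.sum_congr rfl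
    intro i _
    rw [pow_succ', AlgEquiv.mul_apply]
  have hti : ∀ i : ℕ, (τ ^ i) t = t := by
    intro i
    induction i with
    | zero => simp
    | succ i ih => rw [pow_succ', AlgEquiv.mul_apply, ih, htt]
  set z := y - t / n with hz
  have hzs : ∑ i ∈ Finset.range n, (τ ^ i) z = 0 := by
    have : ∀ i ∈ Finset.range n, (τ ^ i) z = (τ ^ i) y - t / n := by
      intro i _
      rw [hz, map_sub, map_div₀, hti, map_natCast]
    rw [Finset.sum_congr rfl this, Finset.sum_sub_distrib, ← ht]
    simp only [Finset.sum_const, Finset.card_range, nsmul_eq_mul]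
    field_simp
    ring
  have hz0 : z = 0 := by
    by_contra hz0
    obtain ⟨a, ha0, ha⟩ := hval z hz0
    have ha0' : algebraMap L Ω a ≠ 0 := by simpa using ha0
    set u := z / algebraMap L Ω a with hu
    have hvz : O.valuation z ≠ 0 := by simpa using hz0
    have hvu : O.valuation u = 1 := by
      rw [hu, map_div₀, ha, div_self hvz]
    have huO : u ∈ O := by
      rw [← O.valuation_le_one_iff, hvu]
    have huO' : u⁻¹ ∈ O := by
      rw [← O.valuation_le_one_iff, map_inv₀, hvu, inv_one]
    have hu0 : u ≠ 0 := div_ne_zero hz0 ha0'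
    have hφu : φ ⟨u, huO⟩ ≠ 0 := by
      intro h
      have h1 : (⟨u, huO⟩ * ⟨u⁻¹, huO'⟩ : O) = 1 := Subtype.ext (mul_inv_cancel₀ hu0)
      have h2 := congrArg φ h1
      rw [map_mul, h, zero_mul, map_one] at h2
      exact zero_ne_one h2
    have hpow : ∀ i : ℕ, ∃ h : (τ ^ i) u ∈ O, φ ⟨_, h⟩ = φ ⟨u, huO⟩ := by
      intro i
      induction i with
      | zero => exact ⟨by simpa using huO, by simp⟩
      | succ i ih =>
        obtain ⟨h1, h2⟩ := ih
        obtain ⟨h3, h4⟩ := hτ _ h1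
        have h5 : (τ ^ (i + 1)) u = τ ((τ ^ i) u) := by rw [pow_succ', AlgEquiv.mul_apply]
        refine ⟨h5 ▸ h3, ?_⟩
        rw [← h2]
        refine Eq.trans ?_ h4
        congr 1
        exact Subtype.ext h5
    choose h1 h2 using hpow
    have hus : ∑ i ∈ Finset.range n, (τ ^ i) u = 0 := by
      have : ∀ i ∈ Finset.range n, (τ ^ i) u = (τ ^ i) z / algebraMap L Ω a := by
        intro i _
        rw [hu, map_div₀, AlgEquiv.commutes]
      rw [Finset.sum_congr rfl this, ← Finset.sum_div, hzs, zero_div]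
    have hus' : ∑ i ∈ Finset.range n, (⟨(τ ^ i) u, h1 i⟩ : O) = 0 := by
      apply Subtype.ext
      refine Eq.trans ?_ hus
      exact map_sum O.subtype _ _
    have h3 := congrArg φ hus'
    rw [map_sum, map_zero, Finset.sum_congr rfl (fun i _ => h2 i)] at h3
    simp only [Finset.sum_const, Finset.card_range, nsmul_eq_mul] at h3
    rcases mul_eq_zero.mp h3 with h | h
    · exact hn h
    · exact hφu h
  have hy' : y = t / n := sub_eq_zero.mp hz0
  rw [hy', map_div₀, htt, map_natCast]

section
variable {L Ω : Type} {k κ : Type*} [Field L] [Field Ω] [Field k] [Field κ] [Algebra L Ω]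
    [Algebra k κ] [IsGalois L Ω] [IsGalois k κ] [IsAlgClosed κ]

lemma ker_le_open (O : ValuationSubring Ω) (φ : O →+* κ)
    (hmax : ∀ M : IntermediateField L Ω, ResIn k O φ (M : Set Ω) → M = ⊥)
    (hval : ∀ x : Ω, x ≠ 0 → ∃ a : L, a ≠ 0 ∧ O.valuation (algebraMap L Ω a) = O.valuation x)
    (ρ : (Ω ≃ₐ[L] Ω) →* (κ ≃ₐ[k] κ)) (hρc : Continuous ρ) (hρs : Function.Surjective ρ)
    (hρ : ∀ σ, Compat O φ σ (ρ σ)) (U : Subgroup (Ω ≃ₐ[L] Ω)) [U.Normal]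
    (hU : IsOpen (U : Set (Ω ≃ₐ[L] Ω))) : ρ.ker ≤ U := by
  have hUc : IsClosed (U : Set (Ω ≃ₐ[L] Ω)) := U.isClosed_of_isOpen hU
  have htame : ∀ τ ∈ ρ.ker, ∀ n : ℕ, (n : κ) ≠ 0 → τ ^ n ∈ U → τ ∈ U := by
    intro τ hτ n hn hU'
    have h2 := InfiniteGalois.fixingSubgroup_fixedField ⟨U, hUc⟩
    change (IntermediateField.fixedField U).fixingSubgroup = U at h2
    rw [← h2, IntermediateField.mem_fixingSubgroup_iff]
    intro y hy
    have hτ' := hρ τ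
    rw [MonoidHom.mem_ker.mp hτ] at hτ'
    exact tame_fix O φ hval τ hτ' n hn y
      ((IntermediateField.mem_fixedField_iff _ _).mp hy _ hU')
  let E := (Ω ≃ₐ[L] Ω) ⧸ U
  have : Finite E := Subgroup.quotient_finite_of_isOpen U hU
  let mk : (Ω ≃ₐ[L] Ω) →* E := QuotientGroup.mk' U
  have hmks : Function.Surjective mk := QuotientGroup.mk'_surjective U
  have hmkker : ∀ g, mk g = 1 ↔ g ∈ U := fun g => QuotientGroup.eq_one_iff g
  let I : Subgroup E := ρ.ker.map mk
  have hIn : I.Normal := Subgroup.Normal.map inferInstance mk hmks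
  have hprime : ∀ l : ℕ, l.Prime → l ∣ Nat.card I → (l : κ) = 0 := by
    intro l hl hdvd
    by_contra hne
    have : Fact l.Prime := ⟨hl⟩
    obtain ⟨⟨x, hx⟩, hxo⟩ := exists_prime_orderOf_dvd_card' (G := I) l hdvd
    obtain ⟨τ, hτ, rfl⟩ := hx
    have h1 : mk τ ^ l = 1 := by
      have := pow_orderOf_eq_one (⟨mk τ, ⟨τ, hτ, rfl⟩⟩ : I)
      rw [hxo] at this
      exact congrArg Subtype.val this
    have h2 : τ ∈ U := htame τ hτ l hne (by rw [← hmkker, map_pow, h1])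
    have h3 : (⟨mk τ, ⟨τ, hτ, rfl⟩⟩ : I) = 1 := Subtype.ext ((hmkker τ).mpr h2)
    rw [h3, orderOf_one] at hxo
    exact hl.one_lt.ne hxo
  obtain ⟨p, hp⟩ := CharP.exists κ
  have hrob : I = ⊥ ∨ (p.Prime ∧ IsPGroup p I) := by
    by_cases hcard : Nat.card I = 1
    · exact Or.inl (Subgroup.eq_bot_of_card_eq I hcard)
    · right
      obtain ⟨l, hl, hld⟩ := Nat.exists_prime_and_dvd hcard
      have h0 := hprime l hl hld
      rw [CharP.cast_eq_zero_iff κ p] at h0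
      have hpl : p = l := by
        rcases (Nat.dvd_prime hl).mp h0 with h | h
        · exact absurd h (CharP.char_ne_one κ p)
        · exact h
      subst hpl
      refine ⟨hl, ?_⟩
      have h1 : Nat.card I = p ^ (Nat.card I).primeFactorsList.length := by
        apply Nat.eq_prime_pow_of_unique_prime_dvd Nat.card_pos.ne'
        intro d hd hdd
        have := hprime d hd hdd
        rw [CharP.cast_eq_zero_iff κ p] at this
        exact ((Nat.prime_dvd_prime_iff_eq hl hd).mp this).symm
      exact IsPGroup.of_card h1
  rcases hrob with hI | ⟨hpp, hI⟩
  · intro τ hτ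
    rw [← hmkker]
    have : mk τ ∈ I := ⟨τ, hτ, rfl⟩
    rwa [hI, Subgroup.mem_bot] at this
  · have : Fact p.Prime := ⟨hpp⟩
    let Q := E ⧸ I
    let π : E →* Q := QuotientGroup.mk' I
    have hπk : π.ker = I := QuotientGroup.ker_mk' I
    let γ : (Ω ≃ₐ[L] Ω) →* Q := π.comp mk
    have hγ : ρ.ker ≤ γ.ker := by
      intro g hg
      have h1 : mk g ∈ π.ker := by
        rw [hπk]
        exact ⟨g, hg, rfl⟩
      exact h1
    let α : (κ ≃ₐ[k] κ) →* Q := ρ.liftOfSurjective hρs ⟨γ, hγ⟩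
    have hα : ∀ g, α (ρ g) = γ g := fun g =>
      MonoidHom.liftOfRightInverse_comp_apply ρ _ (Function.rightInverse_surjInv hρs) ⟨γ, hγ⟩ g
    have hq : Topology.IsQuotientMap ρ := hρc.isClosedMap.isQuotientMap hρc hρs
    have hαo : IsOpen (α.ker : Set (κ ≃ₐ[k] κ)) := by
      rw [← hq.isOpen_preimage]
      have hle : U ≤ α.ker.comap ρ := by
        intro g hg
        rw [Subgroup.mem_comap, MonoidHom.mem_ker, hα]
        change π (mk g) = 1
        rw [(hmkker g).mpr hg, map_one]
      exact Subgroup.isOpen_mono hle hU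
    obtain ⟨β, hβo, hβ⟩ := embed_pgroup p (Nat.card E) π (QuotientGroup.mk'_surjective I)
      (by rw [hπk]; exact hI) rfl α hαo
    let H : Subgroup (Ω ≃ₐ[L] Ω) := (β.comp ρ).eqLocus mk
    have hHle : (β.ker.comap ρ) ⊓ U ≤ H := by
      rintro g ⟨h1, h2⟩
      change β (ρ g) = mk g
      rw [(hmkker g).mpr h2]
      exact h1
    have hHo : IsOpen (H : Set (Ω ≃ₐ[L] Ω)) :=
      Subgroup.isOpen_mono hHle ((hβo.preimage hρc).inter hU)
    have hHtop : H = ⊤ := by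
      apply closed_eq_top O φ hmax H (H.isClosed_of_isOpen hHo)
      intro τ
      obtain ⟨σ, rfl⟩ := hρs τ
      have h1 : π (β (ρ σ)) = π (mk σ) := (DFunLike.congr_fun hβ (ρ σ)).trans (hα σ)
      have h2 : (mk σ)⁻¹ * β (ρ σ) ∈ I := by
        rw [← hπk, MonoidHom.mem_ker, map_mul, h1, map_inv, inv_mul_cancel]
      obtain ⟨i, hi, hi'⟩ := h2
      have hρi : ρ (σ * i) = ρ σ := by
        rw [map_mul, MonoidHom.mem_ker.mp hi, mul_one]
      refine ⟨σ * i, ?_, ?_⟩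
      · change β (ρ (σ * i)) = mk (σ * i)
        rw [hρi, map_mul, hi', mul_inv_cancel_left]
      · rw [← hρi]
        exact hρ _
    intro τ hτ
    have h1 : β (ρ τ) = mk τ := (hHtop ▸ Subgroup.mem_top τ : τ ∈ H)
    rw [MonoidHom.mem_ker.mp hτ, map_one] at h1
    exact (hmkker τ).mp h1.symm

lemma core_iso (O : ValuationSubring Ω) (φ : O →+* κ) (hφ : IsLocalHom φ)
    (hsurj : Function.Surjective φ)
    (hmax : ∀ M : IntermediateField L Ω, ResIn k O φ (M : Set Ω) → M = ⊥)
    (hval : ∀ x : Ω, x ≠ 0 → ∃ a : L, a ≠ 0 ∧ O.valuation (algebraMap L Ω a) = O.valuation x)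
    (hc : ∀ τ : κ ≃ₐ[k] κ, ∃ σ : Ω ≃ₐ[L] Ω, Compat O φ σ τ) :
    ∃ e : (Ω ≃ₐ[L] Ω) ≃* (κ ≃ₐ[k] κ), Continuous e ∧ Continuous e.symm := by
  obtain ⟨ρ, hρc, hρs, hρ⟩ := exists_rho O φ hφ hsurj hmax hc
  have hinj : Function.Injective ρ := by
    rw [← MonoidHom.ker_eq_bot_iff, eq_bot_iff]
    intro τ hτ
    by_contra hne
    have hne' : τ ≠ 1 := hne
    have hop : IsOpen ({τ}ᶜ : Set (Ω ≃ₐ[L] Ω)) := isOpen_compl_singleton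
    obtain ⟨W, hW⟩ := ProfiniteGrp.exist_openNormalSubgroup_sub_open_nhds_of_one hop
      (by simpa using hne'.symm)
    have h1 : τ ∈ W.toSubgroup :=
      ker_le_open O φ hmax hval ρ hρc hρs hρ W.toSubgroup W.isOpen' hτ
    exact hW h1 rfl
  let e := MulEquiv.ofBijective ρ ⟨hinj, hρs⟩
  have hec : Continuous e := hρc
  refine ⟨e, hec, ?_⟩
  exact (hec.homeoOfEquivCompactToT2 (f := e.toEquiv)).symm.continuous

end


lemma core_F {F Ω : Type} {k κ : Type*} [Field F] [Field Ω] [Field k] [Field κ] [Algebra F Ω]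
    [Algebra k κ] [IsAlgClosed Ω] [Algebra.IsAlgebraic F Ω] [PerfectField k] [IsGalois k κ]
    [IsAlgClosed κ] (O : ValuationSubring Ω) (φ : O →+* κ) (hφ : IsLocalHom φ)
    (hF : ResIn k O φ (Set.range (algebraMap F Ω)))
    (hlift : ∀ c : κ, ∃ q : Polynomial O, q.Monic ∧
      (∀ i, (q.coeff i : Ω) ∈ Set.range (algebraMap F Ω)) ∧ q.eval₂ φ c = 0) :
    ∃ L : IntermediateField F Ω, IsGalois L Ω ∧
      ∃ e : (Ω ≃ₐ[L] Ω) ≃* (κ ≃ₐ[k] κ), Continuous e ∧ Continuous e.symm := by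
  obtain ⟨L, hL, hmax⟩ := exists_max_res O φ hF
  have hL' : ResIn k O φ (Set.range (algebraMap L Ω)) := by
    rintro _ ⟨x, rfl⟩ hx
    exact hL _ x.2 hx
  have halg : Algebra.IsAlgebraic L Ω := inferInstance
  have hperf : PerfectField L := perfect_of_max O φ hL' hmax
  have hcl : IsAlgClosure L Ω := ⟨inferInstance, halg⟩
  have hgal : IsGalois L Ω := { to_isSeparable := inferInstance, to_normal := IsAlgClosure.normal L Ω }
  have hlift' : ∀ c : κ, ∃ q : Polynomial O, q.Monic ∧
      (∀ i, (q.coeff i : Ω) ∈ Set.range (algebraMap L Ω)) ∧ q.eval₂ φ c = 0 := by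
    intro c
    obtain ⟨q, h1, h2, h3⟩ := hlift c
    refine ⟨q, h1, fun i => ?_, h3⟩
    obtain ⟨x, hx⟩ := h2 i
    exact ⟨algebraMap F L x, hx⟩
  refine ⟨L, hgal, core_iso O φ hφ ?_ hmax (value_of_max O φ hφ hL' hmax) ?_⟩
  · intro c
    obtain ⟨b, hb, -, h⟩ := lift_int (L := L) O φ hlift' c
    exact ⟨_, h⟩
  · intro τ
    refine conj_place O φ hφ hlift' τ.toRingEquiv ?_
    intro x hx
    obtain ⟨r, hr⟩ := hL' _ ⟨x, rfl⟩ hx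
    rw [← hr]
    exact τ.commutes r



lemma gal_cmp (K k κ : Type) [Field K] [Field k] [Field κ] [Algebra K k] [Algebra k κ]
    [Algebra K κ] [IsScalarTower K k κ] [IsPurelyInseparable K k] [IsAlgClosed κ] [IsGalois k κ] :
    ∃ e : (κ ≃ₐ[k] κ) ≃* AbsGal K, Continuous e ∧ Continuous e.symm := by
  have hKk : Algebra.IsAlgebraic K k := inferInstance
  have hK : Algebra.IsAlgebraic K κ := Algebra.IsAlgebraic.trans K k κ
  have : IsAlgClosure K κ := ⟨inferInstance, hK⟩
  let ι : κ ≃ₐ[K] AlgebraicClosure K := IsAlgClosure.equiv K κ (AlgebraicClosure K)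
  let A := separableClosure K (AlgebraicClosure K)
  let f : (κ ≃ₐ[k] κ) →* (A ≃ₐ[K] A) :=
    ((AlgEquiv.restrictNormalHom A).comp (AlgEquiv.autCongr ι).toMonoidHom).comp
      (AlgEquiv.restrictScalarsHom K)
  have hf : ∀ g (c : A), ((f g c : A) : AlgebraicClosure K) = ι (g (ι.symm c)) := by
    intro g c
    exact AlgEquiv.restrictNormal_commutes (AlgEquiv.autCongr ι (g.restrictScalars K)) A c
  have hfc : Continuous f := by
    apply contin_crit
    intro c
    have h1 : {σ : κ ≃ₐ[k] κ | σ (ι.symm c) ∈ ({ι.symm c} : Set κ)} ∈ nhds (1 : κ ≃ₐ[k] κ) :=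
      (isOpen_eval _ _).mem_nhds (by simp)
    refine Filter.mem_of_superset h1 ?_
    intro σ hσ
    have hσ' : σ (ι.symm c) = ι.symm c := hσ
    apply Subtype.ext
    rw [hf, hσ', AlgEquiv.apply_symm_apply]
  obtain ⟨q, hq⟩ := ExpChar.exists K
  have hqκ : ExpChar κ q := expChar_of_injective_algebraMap (algebraMap K κ).injective q
  have hinj : Function.Injective f := by
    rw [← MonoidHom.ker_eq_bot_iff, eq_bot_iff]
    intro g hg
    have hg1 : f g = 1 := hg
    rw [Subgroup.mem_bot]
    ext x
    rw [AlgEquiv.one_apply]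
    obtain ⟨n, y, hy⟩ := IsPurelyInseparable.pow_mem (separableClosure K κ) q x
    have hyA : ι (y : κ) ∈ A := by
      rw [mem_separableClosure_iff]
      have := mem_separableClosure_iff.mp y.2
      rw [IsSeparable, minpoly.algEquiv_eq]
      exact this
    have h2 := hf g ⟨_, hyA⟩
    rw [hg1, AlgEquiv.one_apply] at h2
    simp only [AlgEquiv.symm_apply_apply] at h2
    have h3 : (y : κ) = g y := ι.injective h2
    have h4 : (y : κ) = x ^ q ^ n := hy
    rw [h4, map_pow] at h3
    exact (iterateFrobenius_inj κ q n h3).symm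
  have hsurj : Function.Surjective f := by
    intro τ
    obtain ⟨σ, hσ⟩ := AlgEquiv.restrictNormalHom_surjective (F := K) (K₁ := A) (AlgebraicClosure K) τ
    let g0 : κ ≃ₐ[K] κ := (AlgEquiv.autCongr ι).symm σ
    have hg0 : AlgEquiv.autCongr ι g0 = σ := (AlgEquiv.autCongr ι).apply_symm_apply σ
    have hk : ∀ r : k, g0 (algebraMap k κ r) = algebraMap k κ r := by
      intro r
      obtain ⟨n, y, hy⟩ := IsPurelyInseparable.pow_mem K q r
      apply iterateFrobenius_inj κ q n
      simp only [iterateFrobenius_def]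
      rw [← map_pow, ← map_pow, ← hy, ← IsScalarTower.algebraMap_apply, AlgEquiv.commutes]
    let g : κ ≃ₐ[k] κ := { g0 with commutes' := hk }
    refine ⟨g, ?_⟩
    rw [← hσ, ← hg0]
    rfl
  let e := MulEquiv.ofBijective f ⟨hinj, hsurj⟩
  have hec : Continuous e := hfc
  exact ⟨e, hec, (hec.homeoOfEquivCompactToT2 (f := e.toEquiv)).symm.continuous⟩



lemma hahn_mul_coeff {Γ R : Type*} [AddCommGroup Γ] [LinearOrder Γ] [IsOrderedAddMonoid Γ]
    [CommRing R] (x y : HahnSeries Γ R) (hx : ∀ g < 0, x.coeff g = 0) (hy : ∀ g < 0, y.coeff g = 0) :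
    (∀ g < 0, (x * y).coeff g = 0) ∧ (x * y).coeff 0 = x.coeff 0 * y.coeff 0 := by
  have hnn : ∀ (z : HahnSeries Γ R), (∀ g < 0, z.coeff g = 0) → ∀ g ∈ z.support, 0 ≤ g := by
    intro z hz g hg
    by_contra h
    exact hg (hz g (not_le.mp h))
  constructor
  · intro g hg
    rw [HahnSeries.coeff_mul]
    apply Finset.sum_eq_zero
    rintro ⟨i, j⟩ hij
    rw [Finset.mem_antidiagonal] at hij
    obtain ⟨h1, h2, h3⟩ := hij
    have h4 := add_nonneg (hnn x hx _ h1) (hnn y hy _ h2)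
    exact absurd hg (not_lt.mpr (h3 ▸ h4))
  · rw [HahnSeries.coeff_mul]
    rw [Finset.sum_eq_single (0, 0)]
    · rintro ⟨i, j⟩ hij hne
      rw [Finset.mem_antidiagonal] at hij
      obtain ⟨h1, h2, h3⟩ := hij
      exfalso
      apply hne
      have := (add_eq_zero_iff_of_nonneg (hnn x hx _ h1) (hnn y hy _ h2)).mp h3
      exact Prod.ext this.1 this.2
    · intro h
      rw [Finset.mem_antidiagonal] at h
      by_contra h0
      exact h ⟨left_ne_zero_of_mul h0, right_ne_zero_of_mul h0, add_zero 0⟩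

lemma hahn_inv {Γ R : Type*} [AddCommGroup Γ] [LinearOrder Γ] [IsOrderedAddMonoid Γ]
    [Field R] (x : HahnSeries Γ R) (hx : ∀ g < 0, x.coeff g = 0) (hx0 : x.coeff 0 ≠ 0) :
    (∀ g < 0, (x⁻¹).coeff g = 0) ∧ (x⁻¹).coeff 0 = (x.coeff 0)⁻¹ := by
  have hne : x ≠ 0 := by
    rintro rfl
    exact hx0 rfl
  have ho : x.order = 0 := by
    apply le_antisymm (HahnSeries.order_le_of_coeff_ne_zero hx0)
    by_contra h
    exact (mt HahnSeries.coeff_order_eq_zero.mp hne) (hx _ (not_le.mp h))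
  have ho' : (x⁻¹).order = 0 := by
    have := HahnSeries.order_mul hne (inv_ne_zero hne)
    rw [mul_inv_cancel₀ hne, HahnSeries.order_one, ho, zero_add] at this
    exact this.symm
  have h1 : ∀ g < 0, (x⁻¹).coeff g = 0 := fun g hg =>
    HahnSeries.coeff_eq_zero_of_lt_order (ho' ▸ hg)
  refine ⟨h1, ?_⟩
  have h2 := (hahn_mul_coeff x x⁻¹ hx h1).2
  rw [mul_inv_cancel₀ hne, HahnSeries.coeff_one, if_pos rfl] at h2
  exact eq_inv_of_mul_eq_one_right h2.symm

lemma local_of_inv {M k : Type*} [Field M] [Field k] (W : ValuationSubring M) (θ : W →+* k)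
    (h : ∀ x (hx : x ∈ W), θ ⟨x, hx⟩ ≠ 0 → x⁻¹ ∈ W) : IsLocalHom θ := by
  constructor
  rintro ⟨x, hx⟩ hu
  have h0 := hu.ne_zero
  have hi := h x hx h0
  have hx0 : x ≠ 0 := by
    rintro rfl
    exact h0 (map_zero θ)
  exact IsUnit.of_mul_eq_one ⟨x⁻¹, hi⟩ (Subtype.ext (mul_inv_cancel₀ hx0))

lemma inv_of_local {M k : Type*} [Field M] [Field k] (W : ValuationSubring M) (θ : W →+* k)
    (h : IsLocalHom θ) (x : M) (hx : x ∈ W) (h0 : θ ⟨x, hx⟩ ≠ 0) : x⁻¹ ∈ W := by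
  have hu : IsUnit (⟨x, hx⟩ : W) := h.map_nonunit _ (isUnit_iff_ne_zero.mpr h0)
  obtain ⟨w, hw⟩ := hu.exists_right_inv
  have hw' : x * (w : M) = 1 := congrArg Subtype.val hw
  rw [← eq_inv_of_mul_eq_one_right hw']
  exact w.2

lemma hahn_place {Γ M1 k : Type*} [AddCommGroup Γ] [LinearOrder Γ] [IsOrderedAddMonoid Γ]
    [Field M1] [Field k] (W1 : ValuationSubring M1) (θ1 : W1 →+* k) (hθ1 : IsLocalHom θ1) :
    ∃ (W : ValuationSubring (HahnSeries Γ M1)) (θ : W →+* k), IsLocalHom θ ∧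
      ∀ (x : M1) (hx : x ∈ W1), ∃ h : HahnSeries.C x ∈ W, θ ⟨_, h⟩ = θ1 ⟨x, hx⟩ := by
  let R : Subring (HahnSeries Γ M1) :=
    { carrier := {x | (∀ g < 0, x.coeff g = 0) ∧ x.coeff 0 ∈ W1}
      mul_mem' := by
        rintro x y ⟨h1, h2⟩ ⟨h3, h4⟩
        obtain ⟨h5, h6⟩ := hahn_mul_coeff x y h1 h3
        exact ⟨h5, h6 ▸ mul_mem h2 h4⟩
      one_mem' := by
        refine ⟨fun g hg => ?_, ?_⟩
        · rw [HahnSeries.coeff_one, if_neg hg.ne]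
        · rw [HahnSeries.coeff_one, if_pos rfl]
          exact one_mem _
      add_mem' := by
        rintro x y ⟨h1, h2⟩ ⟨h3, h4⟩
        refine ⟨fun g hg => ?_, ?_⟩
        · rw [HahnSeries.coeff_add, h1 g hg, h3 g hg, add_zero]
        · rw [HahnSeries.coeff_add]
          exact add_mem h2 h4
      zero_mem' := ⟨fun g _ => rfl, zero_mem _⟩
      neg_mem' := by
        rintro x ⟨h1, h2⟩
        refine ⟨fun g hg => ?_, ?_⟩
        · rw [HahnSeries.coeff_neg, h1 g hg, neg_zero]
        · rw [HahnSeries.coeff_neg]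
          exact neg_mem h2 }
  have hR : ∀ x, x ∈ R ∨ x⁻¹ ∈ R := by
    intro x
    by_cases hne : x = 0
    · left
      rw [hne]
      exact zero_mem _
    have hso := HahnSeries.order_mul hne (inv_ne_zero hne)
    rw [mul_inv_cancel₀ hne, HahnSeries.order_one] at hso
    have hpos : ∀ z : HahnSeries Γ M1, 0 < z.order → z ∈ R := by
      intro z hz
      refine ⟨fun g hg => HahnSeries.coeff_eq_zero_of_lt_order (hg.trans hz), ?_⟩
      rw [HahnSeries.coeff_eq_zero_of_lt_order hz]
      exact zero_mem _
    rcases lt_trichotomy x.order 0 with h | h | h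
    · right
      apply hpos
      rw [← neg_eq_of_add_eq_zero_right hso.symm]
      exact neg_pos.mpr h
    · have h1 : ∀ g < 0, x.coeff g = 0 := fun g hg =>
        HahnSeries.coeff_eq_zero_of_lt_order (h ▸ hg)
      have h2 : x.coeff 0 ≠ 0 := by
        rw [← h]
        exact mt HahnSeries.coeff_order_eq_zero.mp hne
      obtain ⟨h3, h4⟩ := hahn_inv x h1 h2
      rcases W1.mem_or_inv_mem (x.coeff 0) with h5 | h5
      · exact Or.inl ⟨h1, h5⟩
      · exact Or.inr ⟨h3, h4 ▸ h5⟩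
    · exact Or.inl (hpos x h)
  let W : ValuationSubring (HahnSeries Γ M1) := ValuationSubring.ofSubring R hR
  have hW : ∀ x, x ∈ W ↔ (∀ g < 0, x.coeff g = 0) ∧ x.coeff 0 ∈ W1 := fun x => Iff.rfl
  let c0 : W →+* W1 :=
    { toFun := fun x => ⟨(x : HahnSeries Γ M1).coeff 0, ((hW _).mp x.2).2⟩
      map_one' := Subtype.ext (by
        change (1 : HahnSeries Γ M1).coeff 0 = 1
        rw [HahnSeries.coeff_one, if_pos rfl])
      map_zero' := rfl
      map_mul' := fun x y => Subtype.ext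
        (hahn_mul_coeff (x : HahnSeries Γ M1) y ((hW _).mp x.2).1 ((hW _).mp y.2).1).2
      map_add' := fun x y => rfl }
  refine ⟨W, θ1.comp c0, ?_, ?_⟩
  · apply local_of_inv
    intro x hx h0
    have h1 : θ1 ⟨x.coeff 0, ((hW _).mp hx).2⟩ ≠ 0 := h0
    have h2 : x.coeff 0 ≠ 0 := by
      intro h
      apply h1
      have : (⟨x.coeff 0, ((hW _).mp hx).2⟩ : W1) = 0 := Subtype.ext h
      rw [this, map_zero]
    obtain ⟨h3, h4⟩ := hahn_inv x ((hW _).mp hx).1 h2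
    exact (hW _).mpr ⟨h3, h4 ▸ inv_of_local W1 θ1 hθ1 _ _ h1⟩
  · intro x hx
    have h0 : (HahnSeries.C x : HahnSeries Γ M1).coeff 0 = x := HahnSeries.coeff_single_same _ _
    refine ⟨(hW _).mpr ⟨fun g hg => ?_, ?_⟩, ?_⟩
    · exact HahnSeries.coeff_single_of_ne hg.ne
    · rw [h0]
      exact hx
    · change θ1 ⟨(HahnSeries.C x : HahnSeries Γ M1).coeff 0, _⟩ = _
      congr 1
      exact Subtype.ext h0

lemma hahn_indep {S M1 : Type*} [LinearOrder S] [Field M1] :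
    AlgebraicIndependent M1 (fun s : S =>
      (HahnSeries.single (toLex (Finsupp.single s (1 : ℤ))) (1 : M1) :
        HahnSeries (Lex (S →₀ ℤ)) M1)) := by
  classical
  let c : (S →₀ ℕ) → Lex (S →₀ ℤ) := fun m => toLex (m.mapRange (fun n : ℕ => (n : ℤ)) rfl)
  have hc : Function.Injective c := by
    intro m m' h
    have h1 := toLex.injective h
    ext s
    have := DFunLike.congr_fun h1 s
    simpa using this
  have key : ∀ f : MvPolynomial S M1, ∀ m, (MvPolynomial.aeval (fun s : S =>
      (HahnSeries.single (toLex (Finsupp.single s (1 : ℤ))) (1 : M1) :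
        HahnSeries (Lex (S →₀ ℤ)) M1)) f).coeff (c m) = f.coeff m := by
    intro f
    induction f using MvPolynomial.induction_on' with
    | monomial u a =>
      intro m
      have hprod : ∀ u : S →₀ ℕ, (u.prod fun s n => ((HahnSeries.single (toLex (Finsupp.single s (1 : ℤ))) (1 : M1) :
        HahnSeries (Lex (S →₀ ℤ)) M1)) ^ n) = HahnSeries.single (c u) 1 := by
        intro u
        induction u using Finsupp.induction_linear with
        | zero =>
          rw [Finsupp.prod_zero_index]
          have : c 0 = 0 := by
            simp only [c, Finsupp.mapRange_zero]
            rfl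
          rw [this]
          rfl
        | add u v hu hv =>
          rw [Finsupp.prod_add_index' (by simp) (by intros; rw [pow_add]), hu, hv,
            HahnSeries.single_mul_single, one_mul]
          congr 2
          apply toLex.symm.injective
          ext s
          simp [c]
        | single s n =>
          rw [Finsupp.prod_single_index (by simp), HahnSeries.single_pow, one_pow]
          congr 2
          apply toLex.symm.injective
          ext s'
          change (n • (Finsupp.single s (1 : ℤ))) s' = _
          simp [c, Finsupp.single_apply]
      rw [MvPolynomial.aeval_monomial, hprod, ← Algebra.smul_def, HahnSeries.coeff_smul,
        MvPolynomial.coeff_monomial, HahnSeries.coeff_single]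
      by_cases h : u = m
      · simp [h]
      · rw [if_neg (fun h' => h (hc h').symm), if_neg h, smul_zero]
    | add p q hp hq =>
      intro m
      rw [map_add, HahnSeries.coeff_add, hp, hq, MvPolynomial.coeff_add]
  rw [algebraicIndependent_iff]
  intro f hf
  ext m
  rw [← key f m, hf]
  rfl


lemma place_F_aux {F0 M k T : Type*} [Field F0] [Field M] [Field k] [Algebra F0 M]
    (W : ValuationSubring M) (θ : W →+* k) (hθ : IsLocalHom θ) (w : T → M)
    (hw : AlgebraicIndependent F0 w) :
    ∃ (V : ValuationSubring (FractionRing (MvPolynomial T F0))) (ψ : V →+* k), IsLocalHom ψ ∧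
      ∀ t (ht : w t ∈ W), ∃ v : V, ψ v = θ ⟨w t, ht⟩ := by
  let f : FractionRing (MvPolynomial T F0) →+* M :=
    IsFractionRing.lift (A := MvPolynomial T F0) (g := (MvPolynomial.aeval w).toRingHom) hw
  let V := W.comap f
  let ψ : V →+* k := θ.comp (f.restrict V W (fun x hx => hx))
  have hψ : ∀ x (hx : x ∈ V), ψ ⟨x, hx⟩ = θ ⟨f x, hx⟩ := fun x hx => rfl
  refine ⟨V, ψ, ?_, ?_⟩
  · apply local_of_inv
    intro x hx h0
    have := inv_of_local W θ hθ (f x) hx h0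
    change f x⁻¹ ∈ W
    rwa [map_inv₀]
  · intro t ht
    have h1 : f (algebraMap (MvPolynomial T F0) _ (MvPolynomial.X t)) = w t := by
      exact (IsFractionRing.lift_algebraMap _ _).trans (MvPolynomial.aeval_X w t)
    have h4 : algebraMap (MvPolynomial T F0) _ (MvPolynomial.X t) ∈ V := by
      change f _ ∈ W
      rw [h1]
      exact ht
    refine ⟨⟨_, h4⟩, ?_⟩
    rw [hψ]
    congr 1
    exact Subtype.ext h1

lemma indep_extend {F0 M1 M T ι S : Type*} [Field F0] [Field M1] [Field M] [Algebra F0 M1]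
    [Algebra F0 M] [Algebra M1 M] [IsScalarTower F0 M1 M] (y : ι → M1)
    (hy : AlgebraicIndependent F0 y) (s : S → M) (hs : AlgebraicIndependent M1 s)
    (e0 : S ⊕ ι ≃ T) : ∃ w : T → M, AlgebraicIndependent F0 w ∧
      ∀ i, w (e0 (Sum.inr i)) = algebraMap M1 M (y i) := by
  let y' : ι → M := fun i => algebraMap M1 M (y i)
  have hy' : AlgebraicIndependent F0 y' :=
    hy.map' (f := IsScalarTower.toAlgHom F0 M1 M) (algebraMap M1 M).injective
  have hsum := AlgebraicIndependent.sumElim_of_tower hy' (S := M1)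
    (by rintro _ ⟨i, rfl⟩; exact ⟨y i, rfl⟩) hs
  refine ⟨_, hsum.comp e0.symm e0.symm.injective, fun i => ?_⟩
  rw [Function.comp_apply, Equiv.symm_apply_apply, Sum.elim_inr]

lemma exists_big_gen (Γ S M1 k : Type) [AddCommGroup Γ] [LinearOrder Γ] [IsOrderedAddMonoid Γ]
    [Field M1] [Field k] (W1 : ValuationSubring M1)
    (θ1 : W1 →+* k) (hθ1 : IsLocalHom θ1) (s : S → HahnSeries Γ M1)
    (hs : AlgebraicIndependent M1 s) :
    ∃ (M : Type) (_ : Field M) (_ : Algebra M1 M) (W : ValuationSubring M) (θ : W →+* k)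
      (s : S → M), IsLocalHom θ ∧ AlgebraicIndependent M1 s ∧
      ∀ (x : M1) (hx : x ∈ W1), ∃ h : algebraMap M1 M x ∈ W, θ ⟨_, h⟩ = θ1 ⟨x, hx⟩ := by
  obtain ⟨W, θ, hθ, hWθ⟩ := hahn_place (Γ := Γ) W1 θ1 hθ1
  refine ⟨HahnSeries Γ M1, inferInstance, inferInstance, W, θ, s, hθ, hs, ?_⟩
  intro x hx
  have h : algebraMap M1 (HahnSeries Γ M1) x = HahnSeries.C x := by
    rw [HahnSeries.algebraMap_apply]
    rfl
  obtain ⟨h1, h2⟩ := hWθ x hx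
  refine ⟨h ▸ h1, ?_⟩
  rw [← h2]
  congr 1

lemma exists_big_aux (S M1 k : Type) [LinearOrder S] [Field M1] [Field k] (W1 : ValuationSubring M1)
    (θ1 : W1 →+* k) (hθ1 : IsLocalHom θ1) :
    ∃ (M : Type) (_ : Field M) (_ : Algebra M1 M) (W : ValuationSubring M) (θ : W →+* k)
      (s : S → M), IsLocalHom θ ∧ AlgebraicIndependent M1 s ∧
      ∀ (x : M1) (hx : x ∈ W1), ∃ h : algebraMap M1 M x ∈ W, θ ⟨_, h⟩ = θ1 ⟨x, hx⟩ :=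
  exists_big_gen (Lex (S →₀ ℤ)) S M1 k W1 θ1 hθ1 _ hahn_indep

lemma exists_big (S M1 k : Type) [Field M1] [Field k] (W1 : ValuationSubring M1)
    (θ1 : W1 →+* k) (hθ1 : IsLocalHom θ1) :
    ∃ (M : Type) (_ : Field M) (_ : Algebra M1 M) (W : ValuationSubring M) (θ : W →+* k)
      (s : S → M), IsLocalHom θ ∧ AlgebraicIndependent M1 s ∧
      ∀ (x : M1) (hx : x ∈ W1), ∃ h : algebraMap M1 M x ∈ W, θ ⟨_, h⟩ = θ1 ⟨x, hx⟩ := by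
  classical
  exact @exists_big_aux S M1 k (linearOrderOfSTO (WellOrderingRel (α := S))) _ _ W1 θ1 hθ1

lemma place_F {F0 M1 k T ι : Type} [Field F0] [Field M1] [Field k] [Algebra F0 M1]
    (W1 : ValuationSubring M1) (θ1 : W1 →+* k) (hθ1 : IsLocalHom θ1) (y : ι → M1)
    (hy : AlgebraicIndependent F0 y) (hyW : ∀ i, y i ∈ W1) (j : ι ↪ T) :
    ∃ (V : ValuationSubring (FractionRing (MvPolynomial T F0))) (ψ : V →+* k), IsLocalHom ψ ∧
      ∀ i, ∃ v : V, ψ v = θ1 ⟨y i, hyW i⟩ := by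
  classical
  let S := ((Set.range j)ᶜ : Set T)
  obtain ⟨M, _, _, W, θ, s, hθ, hs, hWθ⟩ := exists_big S M1 k W1 θ1 hθ1
  let : Algebra F0 M := ((algebraMap M1 M).comp (algebraMap F0 M1)).toAlgebra
  have htow : IsScalarTower F0 M1 M := IsScalarTower.of_algebraMap_eq fun x => rfl
  let e0 : S ⊕ ι ≃ T := (Equiv.sumComm S ι).trans
    ((Equiv.sumCongr (Equiv.ofInjective j j.injective) (Equiv.refl _)).trans
      (Equiv.Set.sumCompl (Set.range j)))
  obtain ⟨w, hw, hwy⟩ := indep_extend y hy s hs e0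
  obtain ⟨V, ψ, hψ, h⟩ := place_F_aux W θ hθ w hw
  refine ⟨V, ψ, hψ, fun i => ?_⟩
  obtain ⟨h1, h2⟩ := hWθ (y i) (hyW i)
  have h3 := hwy i
  obtain ⟨v, hv⟩ := h (e0 (Sum.inr i)) (h3 ▸ h1)
  refine ⟨v, ?_⟩
  rw [hv, ← h2]
  congr 1
  exact Subtype.ext h3


section
variable (p : ℕ) [hp : Fact p.Prime] {k ι : Type} [Field k] [CharP k p]

lemma teich_indep (b : ι → k) [Algebra (ZMod p) k] (hb : AlgebraicIndependent (ZMod p) b) :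
    AlgebraicIndependent ℤ (fun i => WittVector.teichmuller p (b i)) := by
  let y : ι → WittVector p k := fun i => WittVector.teichmuller p (b i)
  have hdiv : ∀ f : MvPolynomial ι ℤ, MvPolynomial.aeval y f = 0 → MvPolynomial.C (p : ℤ) ∣ f := by
    intro f hf
    rw [MvPolynomial.C_dvd_iff_zmod]
    rw [algebraicIndependent_iff] at hb
    apply hb
    have h1 := congrArg (WittVector.constantCoeff : WittVector p k →+* k) hf
    rw [map_zero] at h1
    rw [← h1, MvPolynomial.aeval_def, MvPolynomial.aeval_def, MvPolynomial.eval₂_map,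
      MvPolynomial.hom_eval₂]
    congr 1
    exact RingHom.ext_int _ _
  have hpow : ∀ n : ℕ, ∀ f : MvPolynomial ι ℤ, MvPolynomial.aeval y f = 0 →
      ∀ m, (p : ℤ) ^ n ∣ f.coeff m := by
    intro n
    induction n with
    | zero => intro f _ m; simp
    | succ n ih =>
      intro f hf m
      obtain ⟨g, rfl⟩ := hdiv f hf
      have hg : MvPolynomial.aeval y g = 0 := by
        rw [map_mul] at hf
        refine (mul_eq_zero.mp hf).resolve_left ?_
        rw [MvPolynomial.aeval_C]
        simpa using WittVector.p_nonzero p k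
      rw [MvPolynomial.coeff_C_mul, pow_succ']
      exact mul_dvd_mul_left _ (ih g hg m)
  rw [algebraicIndependent_iff]
  intro f hf
  ext m
  rw [MvPolynomial.coeff_zero]
  by_contra h0
  have h1 := hpow (f.coeff m).natAbs f hf m
  have h2 := Int.natAbs_dvd_natAbs.mpr h1
  rw [Int.natAbs_pow, Int.natAbs_natCast] at h2
  have h3 := Nat.le_of_dvd (Int.natAbs_pos.mpr h0) h2
  exact absurd h3 (not_le.mpr (Nat.lt_pow_self hp.out.one_lt))

lemma witt_place_aux (M1 : Type) [Field M1] [Algebra (WittVector p k) M1]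
    [IsFractionRing (WittVector p k) M1] (b : ι → k) [PerfectRing k p] [Algebra (ZMod p) k]
    (hb : AlgebraicIndependent (ZMod p) b) (F0 : Type) [Field F0] (e : F0 ≃+* ℚ) :
    ∃ (_ : Algebra F0 M1) (W1 : ValuationSubring M1) (θ1 : W1 →+* k)
      (y : ι → M1) (hy : ∀ i, y i ∈ W1), IsLocalHom θ1 ∧ AlgebraicIndependent F0 y ∧
      ∀ i, θ1 ⟨y i, hy i⟩ = b i := by
  let R := WittVector p k
  have hinj : Function.Injective (algebraMap R M1) := IsFractionRing.injective R M1
  have hZ := teich_indep p b hb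
  have hZ' : AlgebraicIndependent ℤ (fun i => algebraMap R M1 (WittVector.teichmuller p (b i))) :=
    hZ.map' (f := (algebraMap R M1).toIntAlgHom) hinj
  have hchar : CharZero M1 := by
    have h1 := hZ'.algebraMap_injective
    refine ⟨fun a c h => ?_⟩
    have : (algebraMap ℤ M1) (a : ℤ) = algebraMap ℤ M1 (c : ℤ) := by simpa using h
    exact_mod_cast h1 this
  have hQ : AlgebraicIndependent ℚ (fun i => algebraMap R M1 (WittVector.teichmuller p (b i))) :=
    have : Algebra.IsAlgebraic ℤ ℚ := IsLocalization.isAlgebraic ℚ (nonZeroDivisors ℤ)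
    hZ'.extendScalars ℚ
  let iA : Algebra F0 M1 := ((algebraMap ℚ M1).comp e.toRingHom).toAlgebra
  have hF : AlgebraicIndependent F0 (fun i => algebraMap R M1 (WittVector.teichmuller p (b i))) := by
    rw [algebraicIndependent_iff] at hQ ⊢
    intro f hf
    have h1 := hQ (MvPolynomial.map e.toRingHom f) (by
      rw [← hf, MvPolynomial.aeval_def, MvPolynomial.aeval_def, MvPolynomial.eval₂_map]
      rfl)
    exact MvPolynomial.map_injective e.toRingHom e.injective (h1.trans (map_zero _).symm)
  let W1 : ValuationSubring M1 := ValuationSubring.ofSubring (algebraMap R M1).range (by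
    intro x
    exact ValuationRing.isInteger_or_isInteger R x)
  let eR : R ≃+* (algebraMap R M1).range := RingEquiv.ofBijective (algebraMap R M1).rangeRestrict
    ⟨fun a c h => hinj (congrArg Subtype.val h), RingHom.rangeRestrict_surjective _⟩
  let θ1 : W1 →+* k := (WittVector.constantCoeff).comp eR.symm.toRingHom
  have hW : ∀ r : R, algebraMap R M1 r ∈ W1 := fun r => ⟨r, rfl⟩
  have hθ : ∀ (r : R) (h : algebraMap R M1 r ∈ W1), θ1 ⟨algebraMap R M1 r, h⟩ = r.coeff 0 := by
    intro r h
    have : eR.symm ⟨algebraMap R M1 r, h⟩ = r := by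
      rw [RingEquiv.symm_apply_eq]
      rfl
    change (eR.symm ⟨algebraMap R M1 r, h⟩).coeff 0 = _
    rw [this]
  refine ⟨iA, W1, θ1, _, fun i => hW _, ?_, hF, fun i => ?_⟩
  · apply local_of_inv
    intro x hx h0
    obtain ⟨r, rfl⟩ := hx
    have h0 : r.coeff 0 ≠ 0 := fun h => h0 ((hθ r (hW r)).trans h)
    obtain ⟨s, hs⟩ := (WittVector.isUnit_of_coeff_zero_ne_zero r h0).exists_right_inv
    refine ⟨s, ?_⟩
    apply eq_inv_of_mul_eq_one_right
    rw [← map_mul, hs, map_one]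
  · exact (hθ _ (hW _)).trans (WittVector.teichmuller_coeff_zero p (b i))

lemma witt_place (b : ι → k) [PerfectRing k p] [Algebra (ZMod p) k]
    (hb : AlgebraicIndependent (ZMod p) b) (F0 : Type) [Field F0] (e : F0 ≃+* ℚ) :
    ∃ (M1 : Type) (_ : Field M1) (_ : Algebra F0 M1) (W1 : ValuationSubring M1) (θ1 : W1 →+* k)
      (y : ι → M1) (hy : ∀ i, y i ∈ W1), IsLocalHom θ1 ∧ AlgebraicIndependent F0 y ∧
      ∀ i, θ1 ⟨y i, hy i⟩ = b i :=
  ⟨FractionRing (WittVector p k), inferInstance,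
    witt_place_aux p (FractionRing (WittVector p k)) b hb F0 e⟩

end


lemma lift_alg {F K κ E0 ι : Type} [Field F] [Field K] [Field κ] [Field E0] [Algebra E0 K]
    [Algebra K κ] [Algebra.IsAlgebraic K κ] (hE0 : ∀ s : Subfield E0, s = ⊤) (b : ι → K)
    (hb : IsTranscendenceBasis E0 b) (V : ValuationSubring F) (χ : V →+* κ) (hχ : IsLocalHom χ)
    (hbV : ∀ i, ∃ v, χ v = algebraMap K κ (b i)) (c : κ) :
    ∃ q : Polynomial V, q.Monic ∧ q.eval₂ χ c = 0 := by
  let S : Subfield κ := { χ.range with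
    inv_mem' := by
      rintro _ ⟨v, rfl⟩
      by_cases h0 : χ v = 0
      · exact ⟨0, by rw [h0, inv_zero, map_zero]⟩
      · have hi := inv_of_local V χ hχ v v.2 h0
        have hv0 : v ≠ 0 := by
          rintro rfl
          exact h0 (map_zero χ)
        have hv0' : (v : F) ≠ 0 := fun h => hv0 (Subtype.ext h)
        refine ⟨⟨(v : F)⁻¹, hi⟩, ?_⟩
        apply eq_inv_of_mul_eq_one_right
        rw [← map_mul, ← map_one χ]
        congr 1
        exact Subtype.ext (mul_inv_cancel₀ hv0') }
  have hSE : ∀ x : E0, algebraMap K κ (algebraMap E0 K x) ∈ S := by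
    intro x
    have h1 := hE0 (S.comap ((algebraMap K κ).comp (algebraMap E0 K)))
    have h2 : x ∈ S.comap ((algebraMap K κ).comp (algebraMap E0 K)) := by
      rw [h1]; trivial
    exact h2
  let A := Algebra.adjoin E0 (Set.range b)
  have hA : ∀ a : A, algebraMap K κ (a : K) ∈ S := by
    rintro ⟨a, ha⟩
    induction ha using Algebra.adjoin_induction with
    | mem x hx =>
      obtain ⟨i, rfl⟩ := hx
      exact hbV i
    | algebraMap r => exact hSE r
    | add x y _ _ hx hy =>
      change algebraMap K κ (x + y) ∈ S
      rw [map_add]; exact add_mem hx hy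
    | mul x y _ _ hx hy =>
      change algebraMap K κ (x * y) ∈ S
      rw [map_mul]; exact mul_mem hx hy
  let f : A →+* S := ((algebraMap K κ).comp A.val.toRingHom).codRestrict S hA
  letI : Algebra A S := f.toAlgebra
  have : IsScalarTower A S κ := IsScalarTower.of_algebraMap_eq (fun x => rfl)
  have h1 : Algebra.IsAlgebraic A K := hb.isAlgebraic
  have h2 : Algebra.IsAlgebraic A κ := Algebra.IsAlgebraic.trans A K κ
  have hinj : Function.Injective (algebraMap A S) := by
    intro x y h
    have h3 : algebraMap K κ (x : K) = algebraMap K κ (y : K) := congrArg Subtype.val h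
    exact Subtype.ext ((algebraMap K κ).injective h3)
  have h3 : Algebra.IsAlgebraic S κ := Algebra.IsAlgebraic.extendScalars hinj
  have h4 : IsIntegral S c := (h3.isAlgebraic c).isIntegral
  let g : V →+* S := χ.codRestrict S (fun v => ⟨v, rfl⟩)
  have hg : Function.Surjective g := by
    rintro ⟨_, v, rfl⟩
    exact ⟨v, rfl⟩
  have h5 : minpoly S c ∈ Polynomial.lifts g := by
    rw [Polynomial.mem_lifts]
    exact Polynomial.map_surjective g hg _
  obtain ⟨q, hq, -, hm⟩ := Polynomial.lifts_and_natDegree_eq_and_monic h5 (minpoly.monic h4)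
  refine ⟨q, hm, ?_⟩
  have h6 := minpoly.aeval S c
  rw [← hq, Polynomial.aeval_def, Polynomial.eval₂_map] at h6
  exact h6

lemma transfer_indep {A B k ι : Type} [Field A] [Field B] [Field k] [Algebra B k] (e : A ≃+* B)
    (b : ι → k) (hb : AlgebraicIndependent B b) :
    ∃ _ : Algebra A k, AlgebraicIndependent A b := by
  let iA : Algebra A k := ((algebraMap B k).comp e.toRingHom).toAlgebra
  refine ⟨iA, ?_⟩
  rw [algebraicIndependent_iff] at hb ⊢
  intro f hf
  have h1 := hb (MvPolynomial.map e.toRingHom f) (by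
    rw [← hf, MvPolynomial.aeval_def, MvPolynomial.aeval_def, MvPolynomial.eval₂_map]
    rfl)
  exact MvPolynomial.map_injective e.toRingHom e.injective (h1.trans (map_zero _).symm)

lemma prime_equiv {A E0 : Type} [Field A] [Field E0] (hE0 : ∀ s : Subfield E0, s = ⊤)
    (f : A →+* E0) : Nonempty (A ≃+* E0) := by
  refine ⟨RingEquiv.ofBijective f ⟨f.injective, fun x => ?_⟩⟩
  have h : x ∈ f.fieldRange := by
    rw [hE0 f.fieldRange]; trivial
  exact h

lemma place_data {k E0 F0 ι : Type} [Field k] [Field E0] [Field F0] [PerfectField k]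
    [Algebra E0 k] (hE0 : ∀ s : Subfield E0, s = ⊤) (b : ι → k)
    (hb : AlgebraicIndependent E0 b)
    (hF0 : Nonempty (F0 ≃+* E0) ∨ Nonempty (F0 ≃+* ℚ)) :
    ∃ (M1 : Type) (_ : Field M1) (_ : Algebra F0 M1) (W1 : ValuationSubring M1) (θ1 : W1 →+* k)
      (y : ι → M1) (hy : ∀ i, y i ∈ W1), IsLocalHom θ1 ∧ AlgebraicIndependent F0 y ∧
      ∀ i, θ1 ⟨y i, hy i⟩ = b i := by
  have case1 : Nonempty (F0 ≃+* E0) → ∃ (M1 : Type) (_ : Field M1) (_ : Algebra F0 M1)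
      (W1 : ValuationSubring M1) (θ1 : W1 →+* k)
      (y : ι → M1) (hy : ∀ i, y i ∈ W1), IsLocalHom θ1 ∧ AlgebraicIndependent F0 y ∧
      ∀ i, θ1 ⟨y i, hy i⟩ = b i := by
    rintro ⟨e⟩
    obtain ⟨iA, hA⟩ := transfer_indep e b hb
    refine ⟨k, inferInstance, iA, ⊤, (⊤ : ValuationSubring k).subtype, b,
      fun i => ValuationSubring.mem_top _, ?_, hA, fun i => rfl⟩
    exact local_of_inv _ _ (fun x _ _ => ValuationSubring.mem_top _)
  rcases hF0 with h | he
  · exact case1 h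
  · obtain ⟨e⟩ := he
    obtain ⟨p, hp⟩ := CharP.exists E0
    rcases CharP.char_is_prime_or_zero E0 p with hpp | rfl
    · have : Fact p.Prime := ⟨hpp⟩
      have : CharP k p := charP_of_injective_algebraMap (algebraMap E0 k).injective p
      have : ExpChar k p := ExpChar.prime hpp
      have : PerfectRing k p := PerfectField.toPerfectRing p
      obtain ⟨e'⟩ := prime_equiv hE0 (ZMod.castHom (dvd_refl p) E0)
      obtain ⟨iA, hA⟩ := transfer_indep e' b hb
      exact witt_place p b hA F0 e
    · have : CharZero E0 := CharP.charP_to_charZero E0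
      obtain ⟨e'⟩ := prime_equiv hE0 (algebraMap ℚ E0)
      exact case1 ⟨e.trans e'⟩

theorem stmt14 (K : Type) [Field K]
    -- `E0` is the prime field of `K`
    (E0 : Type) [Field E0] [Algebra E0 K] (hE0 : ∀ s : Subfield E0, s = ⊤)
    -- `T` is a set of variables with `card T ≥ trans.deg (K / E0)`
    (T : Type) (ι : Type) (b : ι → K) (hb : IsTranscendenceBasis E0 b)
    (hcard : Cardinal.mk ι ≤ Cardinal.mk T)
    -- `F0` is either `E0` or `ℚ`
    (F0 : Type) [Field F0] (hF0 : Nonempty (F0 ≃+* E0) ∨ Nonempty (F0 ≃+* ℚ)) :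
    ∃ (L : Type) (_ : Field L) (_ : Algebra (FractionRing (MvPolynomial T F0)) L),
      Algebra.IsAlgebraic (FractionRing (MvPolynomial T F0)) L ∧
      ∃ e : AbsGal L ≃* AbsGal K, Continuous e ∧ Continuous e.symm := by
  let F := FractionRing (MvPolynomial T F0)
  let Ω := AlgebraicClosure F
  let κ := AlgebraicClosure K
  let k := perfectClosure K κ
  have hperf : PerfectField k := inferInstance
  have halgk : Algebra.IsAlgebraic k κ := inferInstance
  have hcl : IsAlgClosure k κ := ⟨inferInstance, halgk⟩
  have hnorm : Normal k κ := IsAlgClosure.normal k κ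
  have hgal : IsGalois k κ := {}
  obtain ⟨j⟩ : Nonempty (ι ↪ T) := hcard
  have hb' : AlgebraicIndependent E0 (fun i => algebraMap K k (b i)) :=
    hb.1.map' (f := IsScalarTower.toAlgHom E0 K k) (algebraMap K k).injective
  obtain ⟨M1, i1, i2, W1, θ1, y, hyW, hθ1, hy, hyb⟩ :=
    place_data hE0 (fun i => algebraMap K k (b i)) hb' hF0
  obtain ⟨V, ψ, hψ, hψb⟩ := place_F W1 θ1 hθ1 y hy hyW j
  let χ : V →+* κ := (algebraMap k κ).comp ψ
  have hχ : IsLocalHom χ := by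
    apply local_of_inv
    intro x hx h0
    apply inv_of_local V ψ hψ x hx
    intro h
    apply h0
    change algebraMap k κ (ψ ⟨x, hx⟩) = 0
    rw [h, map_zero]
  obtain ⟨O, φ, hφ, hOV, hφψ⟩ := exists_place (Ω := Ω) V χ hχ
  have hF : ResIn k O φ (Set.range (algebraMap F Ω)) := by
    rintro _ ⟨x, rfl⟩ hx
    exact ⟨ψ ⟨x, (hOV x).mp hx⟩, (hφψ ⟨x, (hOV x).mp hx⟩ hx).symm⟩
  let ι' : V →+* O := ((algebraMap F Ω).comp V.subtype).codRestrict O (fun v => (hOV v).mpr v.2)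
  have hφι : φ.comp ι' = χ := by
    ext v
    exact hφψ v _
  have hlift : ∀ c : κ, ∃ q : Polynomial O, q.Monic ∧
      (∀ i, (q.coeff i : Ω) ∈ Set.range (algebraMap F Ω)) ∧ q.eval₂ φ c = 0 := by
    intro c
    obtain ⟨q, hq, hqc⟩ := lift_alg hE0 b hb V χ hχ (by
      intro i
      obtain ⟨v, hv⟩ := hψb i
      refine ⟨v, ?_⟩
      change algebraMap k κ (ψ v) = _
      rw [hv, hyb]
      rfl) c
    refine ⟨q.map ι', hq.map ι', fun i => ?_, ?_⟩
    · rw [Polynomial.coeff_map]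
      exact ⟨(q.coeff i : F), rfl⟩
    · rw [Polynomial.eval₂_map, hφι, hqc]
  obtain ⟨L, hL, e, he, he'⟩ := core_F O φ hφ hF hlift
  obtain ⟨e1, h1, h1'⟩ := gal_cmp L L Ω
  obtain ⟨e2, h2, h2'⟩ := gal_cmp K k κ
  refine ⟨L, inferInstance, inferInstance, inferInstance, (e1.symm.trans e).trans e2, ?_, ?_⟩
  · exact h2.comp (he.comp h1')
  · exact h1.comp (he'.comp h2')
end

section
/- Let L/K be a finite Galois extension and ψ : B → Gal(L/K) an epimorphism of finite groups. Then there exists a finitely generated regular field extension E of K and a finite Galois extension F of E containing L such that Gal(F/E) = B and ψ coincides with the restriction map res_{F/L} : Gal(F/E) → Gal(L/K). -/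
open scoped TensorProduct

/-- A field extension `E/K` is regular iff `E/K` is separable and `K` is algebraically
closed in `E`; equivalently (and this is the formulation used here), `E` is linearly
disjoint from an algebraic closure of `K`, i.e. `E ⊗[K] K̄` is an integral domain. -/
def IsRegularExtension (K E : Type) [Field K] [Field E] [Algebra K E] : Prop :=
  IsDomain (E ⊗[K] (AlgebraicClosure K))

theorem aux_fg (K E F : Type) [Field K] [Field E] [Field F] [Algebra K E] [Algebra K F]
    [Algebra E F] [IsScalarTower K E F] [Algebra.EssFiniteType K F] [FiniteDimensional E F] :
    Algebra.EssFiniteType K E := by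
  have h1 : FinTrdeg K E := by
    rw [finTrdeg_iff_trdeg]
    refine lt_of_le_of_lt ?_ (trdeg_lt_aleph0 K F)
    rw [← trdeg_add_eq K E (A := F)]
    exact self_le_add_right _ _
  obtain ⟨E0, hfg, halg⟩ := FinTrdeg.exists_fg_isAlgebraic K E
  have : Algebra.EssFiniteType E0 F := Algebra.EssFiniteType.of_comp K E0 F
  have : Algebra.IsAlgebraic E0 F := Algebra.IsAlgebraic.trans E0 E F
  have : Module.Finite E0 F := Algebra.finite_of_essFiniteType_of_isAlgebraic
  have : Module.Finite E0 E := FiniteDimensional.left E0 E F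
  have : Algebra.EssFiniteType K E0 := IntermediateField.essFiniteType_iff.2 hfg
  exact Algebra.EssFiniteType.comp K E0 E

theorem aux_dom (σ L F A : Type) [Field L] [Field F] [Field A] [Algebra L A] [Algebra L F]
    [Algebra (MvPolynomial σ L) F] [IsScalarTower L (MvPolynomial σ L) F]
    [IsFractionRing (MvPolynomial σ L) F] : IsDomain (F ⊗[L] A) := by
  let f : (MvPolynomial σ L) ⊗[L] A →ₐ[L] F ⊗[L] A :=
    Algebra.TensorProduct.map (IsScalarTower.toAlgHom L (MvPolynomial σ L) F) (AlgHom.id L A)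
  let : Algebra ((MvPolynomial σ L) ⊗[L] A) (F ⊗[L] A) := f.toRingHom.toAlgebra
  have hf : ∀ x, algebraMap ((MvPolynomial σ L) ⊗[L] A) (F ⊗[L] A) x = f x := fun _ => rfl
  have : IsScalarTower (MvPolynomial σ L) ((MvPolynomial σ L) ⊗[L] A) (F ⊗[L] A) := by
    refine IsScalarTower.of_algebraMap_eq (R := MvPolynomial σ L)
      (S := (MvPolynomial σ L) ⊗[L] A) (A := F ⊗[L] A) fun x => ?_
    rw [hf, Algebra.TensorProduct.algebraMap_apply]
    simp [f]
  have hloc := IsLocalization.tensorProduct_tensorProduct L A (nonZeroDivisors (MvPolynomial σ L)) F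
    (by ext x; simp [hf, f])
  have hd : IsDomain ((MvPolynomial σ L) ⊗[L] A) :=
    ((Algebra.TensorProduct.comm L (MvPolynomial σ L) A).toRingEquiv.trans
      (MvPolynomial.algebraTensorAlgEquiv L A (σ := σ)).toRingEquiv).toMulEquiv.isDomain _
  refine IsLocalization.isDomain_of_le_nonZeroDivisors (M := Algebra.algebraMapSubmonoid (MvPolynomial σ L ⊗[L] A) (nonZeroDivisors (MvPolynomial σ L))) _ ?_
  rintro _ ⟨p, hp, rfl⟩
  refine mem_nonZeroDivisors_of_ne_zero fun h => nonZeroDivisors.ne_zero hp ?_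
  have hinj : Function.Injective (Algebra.TensorProduct.includeLeft :
      MvPolynomial σ L →ₐ[L] (MvPolynomial σ L) ⊗[L] A) :=
    Algebra.TensorProduct.includeLeft_injective (algebraMap L A).injective
  apply hinj
  rw [map_zero]
  exact h

theorem aux_inj (K L E F : Type) [Field K] [Field L] [Field E] [Field F] [Algebra K L]
    [Algebra K E] [Algebra K F] [Algebra E F] [Algebra L F] [IsScalarTower K E F]
    [IsScalarTower K L F] [FiniteDimensional K L] [IsGalois K L]
    (h : ∀ σ : L ≃ₐ[K] L, ∃ g : F →ₐ[E] F, ∀ x, g (algebraMap L F x) = algebraMap L F (σ x)) :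
    Function.Injective (Algebra.TensorProduct.lift (Algebra.ofId L F)
      (IsScalarTower.toAlgHom K E F) (fun _ _ => Commute.all _ _)) := by
  classical
  choose g hg using h
  let a := Module.finBasis K L
  let φ := (Algebra.TensorProduct.lift (Algebra.ofId L F)
      (IsScalarTower.toAlgHom K E F) (fun _ _ => Commute.all _ _))
  rw [injective_iff_map_eq_zero]
  intro z hz
  have hrep : ∀ z : L ⊗[K] E, ∃ c : Fin (Module.finrank K L) → E, z = ∑ i, a i ⊗ₜ[K] c i := by
    intro z
    induction z using TensorProduct.induction_on with
    | zero => exact ⟨0, by simp⟩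
    | tmul x y =>
      refine ⟨fun i => a.repr x i • y, ?_⟩
      conv_lhs => rw [← a.sum_repr x, TensorProduct.sum_tmul]
      simp only [TensorProduct.smul_tmul]
    | add x y hx hy =>
      obtain ⟨c, rfl⟩ := hx
      obtain ⟨d, rfl⟩ := hy
      exact ⟨c + d, by simp [TensorProduct.tmul_add, Finset.sum_add_distrib]⟩
  obtain ⟨c, hc⟩ := hrep z
  subst hc
  have h0 : ∑ i, algebraMap L F (a i) * algebraMap E F (c i) = 0 := by
    simpa [Algebra.ofId_apply] using hz
  have key : ∀ j, c j = 0 := by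
    intro j
    have h1 : ∑ σ : L ≃ₐ[K] L, g σ (algebraMap L F (a.traceDual j) *
        ∑ i, algebraMap L F (a i) * algebraMap E F (c i)) = 0 := by
      simp [h0]
    have h2 : ∀ i, ∑ σ : L ≃ₐ[K] L, algebraMap L F (σ (a.traceDual j * a i)) =
        if i = j then 1 else 0 := by
      intro i
      rw [← map_sum, ← trace_eq_sum_automorphisms, Module.Basis.trace_traceDual_mul]
      split_ifs <;> simp_all
    simp only [Finset.mul_sum, map_sum, ← mul_assoc, ← map_mul] at h1
    simp only [map_mul (g _), hg, AlgHom.commutes] at h1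
    rw [Finset.sum_comm] at h1
    simp only [← Finset.sum_mul, h2] at h1
    simpa using h1
  simp [key]

theorem aux_reg (K L E F A : Type) [Field K] [Field L] [Field E] [Field F] [Field A] [Algebra K L]
    [Algebra K E] [Algebra K F] [Algebra E F] [Algebra L F] [IsScalarTower K E F]
    [IsScalarTower K L F] [Algebra K A] [Algebra L A] [IsScalarTower K L A]
    (hd : IsDomain (F ⊗[L] A))
    (h : Function.Injective (Algebra.TensorProduct.lift (Algebra.ofId L F)
      (IsScalarTower.toAlgHom K E F) (fun _ _ => Commute.all _ _))) :
    IsDomain (E ⊗[K] A) := by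
  let φ : L ⊗[K] E →ₐ[L] F := (Algebra.TensorProduct.lift (Algebra.ofId L F)
      (IsScalarTower.toAlgHom K E F) (fun _ _ => Commute.all _ _))
  let Φ : A ⊗[L] (L ⊗[K] E) →ₐ[L] A ⊗[L] F := Algebra.TensorProduct.map (AlgHom.id L A) φ
  have hΦ : Function.Injective Φ :=
    Module.Flat.lTensor_preserves_injective_linearMap (M := A) φ.toLinearMap h
  have : IsDomain (A ⊗[L] F) := (Algebra.TensorProduct.comm L A F).toRingEquiv.toMulEquiv.isDomain _
  have : IsDomain (A ⊗[L] (L ⊗[K] E)) := hΦ.isDomain Φ.toRingHom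
  exact ((Algebra.TensorProduct.comm K E A).toRingEquiv.trans
    (Algebra.TensorProduct.cancelBaseChange K L L A E).symm.toRingEquiv).toMulEquiv.isDomain _

@[reducible]
noncomputable def polyAct {K L B : Type} [Field K] [Field L] [Algebra K L] [Group B]
    (ψ : B →* (L ≃ₐ[K] L)) : MulSemiringAction B (MvPolynomial B L) where
  smul b p := MvPolynomial.eval₂Hom (MvPolynomial.C.comp (ψ b : L →+* L))
    (fun c => MvPolynomial.X (b * c)) p
  one_smul p := by
    change MvPolynomial.eval₂Hom _ _ p = RingHom.id _ p
    congr 1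
    ext <;> simp
  mul_smul b c p := by
    change MvPolynomial.eval₂Hom _ _ p = ((MvPolynomial.eval₂Hom (MvPolynomial.C.comp (ψ b : L →+* L))
      (fun c => MvPolynomial.X (b * c))).comp (MvPolynomial.eval₂Hom (MvPolynomial.C.comp (ψ c : L →+* L))
      (fun d => MvPolynomial.X (c * d)))) p
    congr 1
    ext <;> simp [mul_assoc]
  smul_zero b := map_zero (MvPolynomial.eval₂Hom _ _)
  smul_add b p q := map_add (MvPolynomial.eval₂Hom _ _) p q
  smul_one b := map_one (MvPolynomial.eval₂Hom _ _)
  smul_mul b p q := map_mul (MvPolynomial.eval₂Hom _ _) p q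

theorem stmt15 (K L : Type) [Field K] [Field L] [Algebra K L]
    [FiniteDimensional K L] [IsGalois K L]
    (B : Type) [Group B] [Finite B] (ψ : B →* (L ≃ₐ[K] L)) (hψ : Function.Surjective ψ) :
    ∃ (E : Type) (_ : Field E) (_ : Algebra K E)
      (F : Type) (_ : Field F) (_ : Algebra K F) (_ : Algebra E F) (_ : Algebra L F)
      (_ : IsScalarTower K E F) (_ : IsScalarTower K L F),
      -- `E/K` is a finitely generated field extension
      (∃ s : Finset E, IntermediateField.adjoin K (s : Set E) = ⊤) ∧
      -- `E/K` is regular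
      IsRegularExtension K E ∧
      -- `F/E` is a finite Galois extension
      FiniteDimensional E F ∧ IsGalois E F ∧
      -- `Gal(F/E) = B`, and `ψ` coincides with the restriction map `Gal(F/E) → Gal(L/K)`
      ∃ e : B ≃* (F ≃ₐ[E] F),
        ∀ (b : B) (x : L), (e b) (algebraMap L F x) = algebraMap L F (ψ b x) := by
  let act := polyAct ψ
  have hC : ∀ (b : B) (x : L), b • (MvPolynomial.C x : MvPolynomial B L) = MvPolynomial.C (ψ b x) :=
    fun b x => by
      refine (MvPolynomial.eval₂Hom_C _ _ _).trans ?_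
      simp
  have hX : ∀ (b c : B), b • (MvPolynomial.X c : MvPolynomial B L) = MvPolynomial.X (b * c) :=
    fun b x => MvPolynomial.eval₂Hom_X' _ _ _
  let F := FractionRing (MvPolynomial B L)
  let actF : MulSemiringAction B F := IsFractionRing.mulSemiringAction B (MvPolynomial B L) F
  have hsm : ∀ (b : B) (p : MvPolynomial B L), b • algebraMap _ F p = algebraMap _ F (b • p) :=
    fun b p => IsFractionRing.ringEquivOfRingEquiv_algebraMap _ _
  have hL : ∀ (b : B) (x : L), b • algebraMap L F x = algebraMap L F (ψ b x) := by
    intro b x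
    rw [IsScalarTower.algebraMap_apply L (MvPolynomial B L) F, hsm, MvPolynomial.algebraMap_eq, hC]
    rw [IsScalarTower.algebraMap_apply L (MvPolynomial B L) F, MvPolynomial.algebraMap_eq]
  have hinj := IsFractionRing.injective (MvPolynomial B L) F
  have : FaithfulSMul B F := ⟨fun {b c} h => by
    have := h (algebraMap (MvPolynomial B L) F (MvPolynomial.X 1))
    rw [hsm, hsm, hX, hX] at this
    simpa using MvPolynomial.X_injective (hinj this)⟩
  have : SMulCommClass B K F := ⟨fun b k x => by
    rw [Algebra.smul_def, Algebra.smul_def, smul_mul', IsScalarTower.algebraMap_apply K L F, hL, AlgEquiv.commutes]⟩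
  let E : IntermediateField K F := FixedPoints.intermediateField B
  have : IsGaloisGroup B E F := IsGaloisGroup.fixedPoints B F
  have : FiniteDimensional E F := IsGaloisGroup.finiteDimensional B E F
  have : IsGalois E F := IsGaloisGroup.isGalois B E F
  have : Algebra.EssFiniteType (MvPolynomial B L) F := .of_isLocalization _ (nonZeroDivisors _)
  have : Algebra.EssFiniteType L F := .comp L (MvPolynomial B L) F
  have : Algebra.EssFiniteType K F := .comp K L F
  have : Algebra.EssFiniteType K E := aux_fg K E F
  have hreg : IsRegularExtension K E := by
    let i : L →ₐ[K] AlgebraicClosure K := IsAlgClosed.lift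
    let : Algebra L (AlgebraicClosure K) := i.toRingHom.toAlgebra
    have : IsScalarTower K L (AlgebraicClosure K) :=
      IsScalarTower.of_algebraMap_eq fun x => (i.commutes x).symm
    refine aux_reg K L E F (AlgebraicClosure K) (aux_dom B L F _) (aux_inj K L E F fun σ => ?_)
    obtain ⟨b, rfl⟩ := hψ σ
    exact ⟨(IsGaloisGroup.mulEquivAlgEquiv B E F b : F →ₐ[E] F), fun x => hL b x⟩
  exact ⟨E, inferInstance, inferInstance, F, inferInstance, inferInstance, inferInstance,
    inferInstance, inferInstance, inferInstance, IntermediateField.fg_top K E, hreg,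
    inferInstance, inferInstance, IsGaloisGroup.mulEquivAlgEquiv B E F, fun b x => hL b x⟩
end
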